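/- arXiv:1910.12509 — 5 statements merged into one kernel-verified Lean document; each statement's English description precedes it below -/
import Mathlib

section
/- Let k and t be integers with 0 ≤ t < k, and let λ_{k,t} be the multiset consisting of t copies of 1 together with one copy of k − t. Then every finite simple graph G with chromatic number equal to k and at most 2k + t + 1 vertices is λ_{k,t}-choosable. -/
open SimpleGraph

/-- `G` has a proper colouring from the lists `L`. -/
def ListColourable {V : Type*} (G : SimpleGraph V) (L : V → Finset ℕ) : Prop :=
  ∃ f : V → ℕ, (∀ v, f v ∈ L v) ∧ ∀ ⦃u w⦄, G.Adj u w → f u ≠ f w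

/-- `L` is a `lam`-list assignment: the elements `k_1, …, k_q` of the multiset `lam`
can be enumerated by a list `l`, and there are pairwise disjoint colour sets
`C 1, …, C q` such that `|L v ∩ C i| ≥ k_i` for every vertex `v` and every `i`. -/
def IsLamAssignment {V : Type*} (lam : Multiset ℕ) (L : V → Finset ℕ) : Prop :=
  ∃ (l : List ℕ) (C : Fin l.length → Finset ℕ),
    (l : Multiset ℕ) = lam ∧
    (∀ i j, i ≠ j → Disjoint (C i) (C j)) ∧
    ∀ (v : V) (i : Fin l.length), l.get i ≤ ((L v) ∩ C i).card

/-- `G` is `lam`-choosable. -/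
def LamChoosable {V : Type*} (G : SimpleGraph V) (lam : Multiset ℕ) : Prop :=
  ∀ L : V → Finset ℕ, IsLamAssignment lam L → ListColourable G L

namespace Ohba

open Finset Function

open scoped Classical

noncomputable section

set_option linter.unusedSectionVars false

/-- There is a choice of colours from the lists `L` in which vertices of equal colour lie in the
same part of the partition given by the fibres of `p`. -/
def Good {V ι α : Type*} (p : V → ι) (L : V → Finset α) : Prop :=
  ∃ f : V → α, (∀ v, f v ∈ L v) ∧ ∀ u w, f u = f w → p u = p w

/-- Hall's theorem for the vertices in a finite set. -/
lemma exists_injOn_of_hall {V α : Type*} (f : V → α) {s : Finset V} (N : V → Finset α)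
    (h : ∀ A ⊆ s, A.card ≤ (A.biUnion N).card) :
    ∃ e : V → α, (∀ v ∈ s, e v ∈ N v) ∧ Set.InjOn e s := by
  obtain ⟨e, he, heN⟩ :=
    (all_card_le_biUnion_card_iff_exists_injective (fun v : s => N v.1)).1 fun A => by
      have h1 := h (A.map (Embedding.subtype _)) fun v hv => by
        obtain ⟨w, -, rfl⟩ := mem_map.1 hv
        exact w.2
      rw [card_map] at h1
      refine h1.trans (card_le_card ?_)
      intro c hc
      simp only [mem_biUnion, mem_map] at hc ⊢
      obtain ⟨_, ⟨w, hw, rfl⟩, hcw⟩ := hc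
      exact ⟨w, hw, hcw⟩
  refine ⟨fun v => if hv : v ∈ s then e ⟨v, hv⟩ else f v, fun v hv => ?_, ?_⟩
  · simpa only [hv, dif_pos] using heN ⟨v, hv⟩
  · intro u hu w hw huw
    have hu' : u ∈ s := hu
    have hw' : w ∈ s := hw
    simp only [hu', hw', dif_pos] at huw
    exact congrArg Subtype.val (he huw)

lemma exists_injOn_of_card_le {V α : Type*} (f : V → α) {s : Finset V} {t : Finset α}
    (h : s.card ≤ t.card) : ∃ e : V → α, (∀ v ∈ s, e v ∈ t) ∧ Set.InjOn e s := by
  refine exists_injOn_of_hall f (fun _ => t) fun A hA => ?_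
  rcases A.eq_empty_or_nonempty with rfl | ⟨a, ha⟩
  · simp
  · exact ((card_le_card hA).trans h).trans
      (card_le_card (subset_biUnion_of_mem (fun _ : V => t) ha))

lemma sum_card_inter {V α : Type*} (L : V → Finset α) (X : Finset V) (H : Finset α) :
    ∑ v ∈ X, (L v ∩ H).card = ∑ t ∈ H, (X.filter fun v => t ∈ L v).card := by
  have := sum_card_bipartiteAbove_eq_sum_card_bipartiteBelow (s := X) (t := H)
    (fun v t => t ∈ L v)
  simp only [bipartiteAbove, bipartiteBelow] at this
  rw [← this]
  refine sum_congr rfl fun v _ => congrArg card ?_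
  ext t
  simp [and_comm]

section Partition

variable {V ι α : Type*} [Fintype V] [Fintype ι] [Fintype α]

/-- The part with index `i`. -/
def part (p : V → ι) (i : ι) : Finset V := {v | p v = i}

/-- A minimal non-colourable instance, with maximal lists. -/
structure Crit (p : V → ι) (L : V → Finset α) : Prop where
  surj : Surjective p
  card_eq : Fintype.card V = 2 * Fintype.card ι + 1
  le_card : ∀ v, Fintype.card ι ≤ (L v).card
  not_good : ¬ Good p L
  no_common : ∀ c i, (∀ v, p v = i → c ∈ L v) → (part p i).card ≤ 1
  exists_host : ∃ g : α → V, Injective g ∧ ∀ c, c ∈ L (g c)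
  maximal : ∀ v c, c ∉ L v → Good p (update L v (insert c (L v)))

/-- `f` is constant only inside parts, and colours assigned outside the lists are used once. -/
def Near (p : V → ι) (L : V → Finset α) (f : V → α) : Prop :=
  (∀ u w, f u = f w → p u = p w) ∧ ∀ v, f v ∈ L v ∨ ∀ u, f u = f v → u = v

/-- The colours common to all lists of the vertices in the class `f ⁻¹ {x}`. -/
def common (L : V → Finset α) (f : V → α) (x : α) : Finset α := {c | ∀ v, f v = x → c ∈ L v}

/-- The classes of `f` none of whose common colours is in `T`. -/
def nonadj (L : V → Finset α) (f : V → α) (T : Finset α) : Finset α :=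
  {x | Disjoint (common L f x) T}

/-- `T` witnesses a failure of Hall's condition for the classes of the near colouring `f`. -/
def Viol (p : V → ι) (L : V → Finset α) (f : V → α) (T : Finset α) : Prop :=
  Near p L f ∧ Fintype.card α + 1 ≤ (nonadj L f T).card + T.card

variable {p : V → ι} {L : V → Finset α} {f : V → α} {T T' : Finset α}

lemma mem_part {i : ι} {v : V} : v ∈ part p i ↔ p v = i := by simp [part]

lemma mem_common {c x : α} : c ∈ common L f x ↔ ∀ v, f v = x → c ∈ L v := by simp [common]

lemma mem_nonadj {x : α} : x ∈ nonadj L f T ↔ ∀ c ∈ T, ∃ v, f v = x ∧ c ∉ L v := by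
  simp only [nonadj, mem_filter, mem_univ, true_and, Finset.disjoint_right, mem_common]
  push Not
  rfl

lemma nonadj_anti (h : T ⊆ T') : nonadj L f T' ⊆ nonadj L f T := fun _ hx =>
  mem_nonadj.2 fun c hc => mem_nonadj.1 hx c (h hc)

lemma nonadj_union : nonadj L f (T ∪ T') = nonadj L f T ∩ nonadj L f T' := by
  ext x
  simp only [mem_inter, mem_nonadj, mem_union]
  exact ⟨fun h => ⟨fun c hc => h c (Or.inl hc), fun c hc => h c (Or.inr hc)⟩,
    fun h c hc => hc.elim (h.1 c) (h.2 c)⟩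

lemma nonadj_supermodular :
    ((nonadj L f T).card + T.card) + ((nonadj L f T').card + T'.card) ≤
      ((nonadj L f (T ∪ T')).card + (T ∪ T').card) +
        ((nonadj L f (T ∩ T')).card + (T ∩ T').card) := by
  have h1 := card_union_add_card_inter T T'
  have h2 := card_union_add_card_inter (nonadj L f T) (nonadj L f T')
  rw [← nonadj_union] at h2
  have h3 : (nonadj L f T ∪ nonadj L f T').card ≤ (nonadj L f (T ∩ T')).card :=
    card_le_card <| union_subset (nonadj_anti inter_subset_left) (nonadj_anti inter_subset_right)
  omega

/-- Without a violator, the classes of `f` can be matched to common colours. -/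
lemma good_of_forall_nonadj (hf : ∀ u w, f u = f w → p u = p w)
    (h : ∀ T, (nonadj L f T).card + T.card ≤ Fintype.card α) : Good p L := by
  have hall : ∀ A : Finset α, A.card ≤ (A.biUnion (common L f)).card := by
    intro A
    have h1 := h (A.biUnion (common L f))ᶜ
    have h2 : A ⊆ nonadj L f (A.biUnion (common L f))ᶜ := by
      intro x hx
      simp only [nonadj, mem_filter, mem_univ, true_and]
      exact (_root_.disjoint_compl_right).mono_left (subset_biUnion_of_mem (common L f) hx)
    have h3 := card_le_card h2
    have h4 := card_add_card_compl (A.biUnion (common L f))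
    omega
  obtain ⟨h, hinj, hh⟩ := (all_card_le_biUnion_card_iff_exists_injective (common L f)).1 hall
  exact ⟨fun v => h (f v), fun v => mem_common.1 (hh (f v)) v rfl,
    fun u w huw => hf u w (hinj huw)⟩

lemma Crit.exists_viol (hc : Crit p L) (hf : Near p L f) : ∃ T, Viol p L f T := by
  by_contra hT
  refine hc.not_good (good_of_forall_nonadj hf.1 fun T => ?_)
  by_contra hcard
  exact hT ⟨T, hf, by omega⟩

lemma Viol.nonempty (h : Viol p L f T) : T.Nonempty := by
  by_contra hT
  rw [not_nonempty_iff_eq_empty] at hT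
  have h2 := h.2
  have : (nonadj L f T).card ≤ Fintype.card α := card_le_univ _
  rw [hT, card_empty] at h2
  rw [hT] at this
  omega

/-- A violator contains a colour which is assigned outside the lists. -/
lemma Viol.exists_mem (h : Viol p L f T) :
    ∃ w, f w ∈ T ∧ f w ∉ L w ∧ f w ∈ nonadj L f T := by
  by_contra hno
  push Not at hno
  have hsub : nonadj L f T ⊆ Tᶜ := by
    intro x hx
    rw [mem_compl]
    intro hxT
    obtain ⟨v, hv, hxv⟩ := mem_nonadj.1 hx x hxT
    subst hv
    exact hno v hxT hxv hx
  have h1 := card_le_card hsub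
  have h2 := card_add_card_compl T
  have h3 := h.2
  omega

lemma Near.eq_of_notMem {v u : V} (hf : Near p L f) (hv : f v ∉ L v) (h : f u = f v) : u = v :=
  (hf.2 v).resolve_left hv u h

/-- A near colouring whose colours outside the lists are safe does not exist. -/
lemma Crit.false_of_near (hc : Crit p L) {F : Finset α}
    (hF : ∀ c ∈ F, ∀ f T, Viol p L f T → c ∉ T) (hf : Near p L f)
    (h : ∀ v, f v ∈ L v ∨ f v ∈ F) : False := by
  obtain ⟨T, hT⟩ := hc.exists_viol hf
  obtain ⟨w, hwT, hwL, -⟩ := hT.exists_mem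
  exact hF _ ((h w).resolve_left hwL) f T hT hwT

/-- A partial colouring whose uncovered vertices can be given distinct unused safe colours does
not exist. -/
lemma Crit.false_of_cover (hc : Crit p L) {F : Finset α}
    (hF : ∀ c ∈ F, ∀ f T, Viol p L f T → c ∉ T) (D : Finset V)
    (hfL : ∀ v ∈ D, f v ∈ L v) (hf : ∀ u ∈ D, ∀ w ∈ D, f u = f w → p u = p w)
    (hcard : Dᶜ.card ≤ (F \ D.image f).card) : False := by
  obtain ⟨e, he, hinj⟩ := exists_injOn_of_card_le f hcard
  have hmem : ∀ v, v ∉ D → e v ∈ F ∧ ∀ w ∈ D, f w ≠ e v := by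
    intro v hv
    have := he v (mem_compl.2 hv)
    rw [mem_sdiff, mem_image] at this
    exact ⟨this.1, fun w hw h => this.2 ⟨w, hw, h⟩⟩
  refine hc.false_of_near hF (f := fun v => if v ∈ D then f v else e v) ⟨?_, ?_⟩ ?_
  · intro u w huw
    by_cases hu : u ∈ D <;> by_cases hw : w ∈ D <;> simp only [hu, hw, if_true, if_false] at huw
    · exact hf u hu w hw huw
    · exact absurd huw ((hmem w hw).2 u hu)
    · exact absurd huw.symm ((hmem u hu).2 w hw)
    · rw [hinj (by simpa using hu) (by simpa using hw) huw]
  · intro v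
    by_cases hv : v ∈ D
    · left; simpa [hv] using hfL v hv
    · right
      intro u huv
      by_cases hu : u ∈ D <;> simp only [hu, hv, if_true, if_false] at huv
      · exact absurd huv ((hmem v hv).2 u hu)
      · exact hinj (by simpa using hu) (by simpa using hv) huv
  · intro v
    by_cases hv : v ∈ D
    · left; simpa [hv] using hfL v hv
    · right; simpa [hv] using (hmem v hv).1

end Partition

section Count

variable {V ι α : Type*} [Fintype V] [Fintype ι] [Fintype α]

/-- The vertices forming a part on their own. -/
def sing (p : V → ι) : Finset V := {v | (part p (p v)).card = 1}

/-- The vertices in parts of size at least three. -/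
def large (p : V → ι) : Finset V := {v | 3 ≤ (part p (p v)).card}

/-- The indices of parts of size two. -/
def twoIdx (p : V → ι) : Finset ι := {i | (part p i).card = 2}

/-- The indices of parts of size at least three. -/
def largeIdx (p : V → ι) : Finset ι := {i | 3 ≤ (part p i).card}

variable {p : V → ι} {L : V → Finset α} {f : V → α} {T : Finset α}

lemma mem_sing {v : V} : v ∈ sing p ↔ (part p (p v)).card = 1 := by simp [sing]

lemma mem_large {v : V} : v ∈ large p ↔ 3 ≤ (part p (p v)).card := by simp [large]

lemma mem_twoIdx {i : ι} : i ∈ twoIdx p ↔ (part p i).card = 2 := by simp [twoIdx]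

lemma mem_largeIdx {i : ι} : i ∈ largeIdx p ↔ 3 ≤ (part p i).card := by simp [largeIdx]

lemma card_filter_mem (J : Finset ι) :
    (univ.filter fun v => p v ∈ J).card = ∑ i ∈ J, (part p i).card := by
  rw [card_eq_sum_card_fiberwise (f := p) (t := J) (fun v hv => by simpa using hv)]
  refine sum_congr rfl fun i hi => congrArg card ?_
  ext v
  simp only [part, mem_filter, mem_univ, true_and]
  exact ⟨fun h => h.2, fun h => ⟨h ▸ hi, h⟩⟩

lemma eq_of_mem_sing {u v : V} (hu : u ∈ sing p) (h : p v = p u) : v = u := by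
  obtain ⟨w, hw⟩ := card_eq_one.1 (mem_sing.1 hu)
  have h1 : u ∈ part p (p u) := mem_part.2 rfl
  have h2 : v ∈ part p (p u) := mem_part.2 h
  rw [hw, mem_singleton] at h1 h2
  rw [h1, h2]

lemma one_le_card_part (hp : Surjective p) (i : ι) : 1 ≤ (part p i).card := by
  obtain ⟨v, rfl⟩ := hp i
  exact card_pos.2 ⟨v, mem_part.2 rfl⟩

lemma card_sing_eq :
    (sing p).card = (univ.filter fun i => (part p i).card = 1).card := by
  have h := card_filter_mem (p := p) (univ.filter fun i => (part p i).card = 1)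
  rw [sum_congr rfl (g := fun _ => 1) (by simp)] at h
  simpa [sing] using h

lemma card_idx (hp : Surjective p) :
    Fintype.card ι = (sing p).card + (twoIdx p).card + (largeIdx p).card := by
  rw [card_sing_eq, twoIdx, largeIdx, ← card_union_of_disjoint, ← card_union_of_disjoint,
    ← card_univ]
  · congr 1
    ext i
    have := one_le_card_part hp i
    simp only [mem_univ, mem_union, mem_filter, true_and, true_iff]
    omega
  · rw [Finset.disjoint_left]
    intro i
    simp only [mem_univ, mem_union, mem_filter, true_and]
    omega
  · rw [Finset.disjoint_left]
    intro i
    simp only [mem_univ, mem_filter, true_and]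
    omega

lemma card_vertices (hp : Surjective p) :
    Fintype.card V = (sing p).card + 2 * (twoIdx p).card + (large p).card := by
  have h2 : (univ.filter fun v => p v ∈ twoIdx p).card = 2 * (twoIdx p).card := by
    rw [card_filter_mem, sum_congr rfl (g := fun _ => 2) (fun i hi => mem_twoIdx.1 hi)]
    simp [mul_comm]
  rw [← h2, sing, large, ← card_union_of_disjoint, ← card_union_of_disjoint, ← card_univ]
  · congr 1
    ext v
    have := one_le_card_part hp (p v)
    simp only [mem_univ, mem_union, mem_filter, true_and, true_iff, mem_twoIdx]
    omega
  · rw [Finset.disjoint_left]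
    intro v
    simp only [mem_univ, mem_union, mem_filter, true_and, mem_twoIdx]
    omega
  · rw [Finset.disjoint_left]
    intro v
    simp only [mem_univ, mem_filter, true_and, mem_twoIdx]
    omega

lemma three_mul_card_largeIdx_le : 3 * (largeIdx p).card ≤ (large p).card := by
  have h := card_filter_mem (p := p) (largeIdx p)
  have h2 : (univ.filter fun v => p v ∈ largeIdx p) = large p := by
    ext v; simp [mem_largeIdx, mem_large]
  rw [h2] at h
  rw [h, mul_comm, ← smul_eq_mul, ← sum_const]
  exact sum_le_sum fun i hi => mem_largeIdx.1 hi

lemma Crit.card_large (hc : Crit p L) :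
    (large p).card = (sing p).card + 2 * (largeIdx p).card + 1 := by
  have h1 := card_idx hc.surj
  have h2 := card_vertices hc.surj
  have h3 := hc.card_eq
  omega

lemma Crit.card_largeIdx_le (hc : Crit p L) : (largeIdx p).card ≤ (sing p).card + 1 := by
  have h1 := hc.card_large
  have h2 := three_mul_card_largeIdx_le (p := p)
  omega

lemma Crit.card_largeIdx_pos (hc : Crit p L) : 1 ≤ (largeIdx p).card := by
  have h1 := hc.card_large
  obtain ⟨v, hv⟩ : (large p).Nonempty := card_pos.1 (by omega)
  exact card_pos.2 ⟨p v, mem_largeIdx.2 (mem_large.1 hv)⟩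

lemma Crit.le_card_colours (hc : Crit p L) : Fintype.card ι ≤ Fintype.card α := by
  have h := hc.card_eq
  obtain ⟨v⟩ : Nonempty V := Fintype.card_pos_iff.1 (by omega)
  exact (hc.le_card v).trans (card_le_univ _)

lemma Crit.card_colours_le (hc : Crit p L) : Fintype.card α ≤ 2 * Fintype.card ι := by
  obtain ⟨g, hg, hgL⟩ := hc.exists_host
  have h1 := Fintype.card_le_of_injective g hg
  by_contra h2
  have hbij : Bijective g :=
    (Fintype.bijective_iff_injective_and_card g).2 ⟨hg, by have := hc.card_eq; omega⟩
  obtain ⟨e, he⟩ : ∃ e : α ≃ V, ⇑e = g := ⟨Equiv.ofBijective g hbij, rfl⟩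
  refine hc.not_good ⟨e.symm, fun v => ?_, fun u w h => by rw [e.symm.injective h]⟩
  have := hgL (e.symm v)
  rwa [← he, e.apply_symm_apply] at this

lemma Crit.disjoint_of_two (hc : Crit p L) {u w : V} (huw : u ≠ w) (h : p u = p w)
    (hi : p u ∈ twoIdx p) : Disjoint (L u) (L w) := by
  rw [Finset.disjoint_left]
  intro c hcu hcw
  have hsub : ({u, w} : Finset V) = part p (p u) := by
    refine eq_of_subset_of_card_le ?_ ?_
    · intro x hx
      rw [mem_part]
      rcases mem_insert.1 hx with rfl | hx
      · rfl
      · rw [mem_singleton.1 hx, h]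
    · rw [mem_twoIdx.1 hi, card_pair huw]
  have h1 := hc.no_common c (p u) fun v hv => by
    have : v ∈ part p (p u) := mem_part.2 hv
    rw [← hsub] at this
    rcases mem_insert.1 this with rfl | hx
    · exact hcu
    · rwa [mem_singleton.1 hx]
  rw [mem_twoIdx.1 hi] at h1
  omega

lemma exists_two {i : ι} (hi : i ∈ twoIdx p) : ∃ u w, u ≠ w ∧ p u = i ∧ p w = i := by
  obtain ⟨u, w, huw, h⟩ := card_eq_two.1 (mem_twoIdx.1 hi)
  exact ⟨u, w, huw, mem_part.1 (h ▸ by simp), mem_part.1 (h ▸ by simp)⟩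

lemma Crit.two_mul_le_of_disjoint (hc : Crit p L) {u w : V} (h : Disjoint (L u) (L w)) :
    Fintype.card α = 2 * Fintype.card ι ∧ L u ∪ L w = univ := by
  have h1 := hc.le_card u
  have h2 := hc.le_card w
  have h3 := hc.card_colours_le
  have h4 := card_union_of_disjoint h
  have h5 := card_le_univ (L u ∪ L w)
  exact ⟨by omega, (card_eq_iff_eq_univ _).1 (by omega)⟩

lemma Crit.card_colours_of_two (hc : Crit p L) (h : (twoIdx p).card ≠ 0) :
    Fintype.card α = 2 * Fintype.card ι := by
  obtain ⟨i, hi⟩ := card_pos.1 (Nat.pos_of_ne_zero h)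
  obtain ⟨u, w, huw, hu, hw⟩ := exists_two hi
  exact (hc.two_mul_le_of_disjoint
    (hc.disjoint_of_two huw (hu.trans hw.symm) (hu.symm ▸ hi))).1

/-- The singleton parts whose lists meet `T`. -/
def meet (p : V → ι) (L : V → Finset α) (T : Finset α) : Finset V :=
  (sing p).filter fun u => ¬ Disjoint (L u) T

/-- The number of large-part vertices whose lists contain `c`. -/
def largeDeg (p : V → ι) (L : V → Finset α) (c : α) : ℕ :=
  ((large p).filter fun v => c ∈ L v).card

/-- The number of singleton-part vertices whose lists contain `c`. -/
def singDeg (p : V → ι) (L : V → Finset α) (c : α) : ℕ :=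
  ((sing p).filter fun v => c ∈ L v).card

/-- The classes in `nonadj` that contain a vertex of a large part. -/
def largeNonadj (p : V → ι) (L : V → Finset α) (f : V → α) (T : Finset α) : Finset α :=
  (nonadj L f T).filter fun x => ∃ v ∈ large p, f v = x

lemma meet_subset (p : V → ι) (L : V → Finset α) (T : Finset α) : meet p L T ⊆ sing p :=
  filter_subset _ _

lemma singDeg_le_card_meet {c : α} (h : c ∈ T) : singDeg p L c ≤ (meet p L T).card :=
  card_le_card fun u hu => by
    rw [mem_filter] at hu
    exact mem_filter.2 ⟨hu.1, Finset.not_disjoint_iff.2 ⟨c, hu.2, h⟩⟩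

lemma Viol.card_add_le (hc : Crit p L) (h : Viol p L f T) :
    T.card + Fintype.card ι ≤ Fintype.card α := by
  obtain ⟨w, -, hw, hwT⟩ := h.exists_mem
  have hdisj : Disjoint T (L w) := by
    rw [Finset.disjoint_left]
    intro c hc
    obtain ⟨v, hv, hcv⟩ := mem_nonadj.1 hwT c hc
    rwa [h.1.eq_of_notMem hw hv] at hcv
  have h1 := hc.le_card w
  have h2 := card_le_univ (T ∪ L w)
  rw [card_union_of_disjoint hdisj] at h2
  omega

lemma Near.injOn_sing (h : Near p L f) : Set.InjOn f (sing p) := fun _ _ w hw huw =>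
  eq_of_mem_sing hw (h.1 _ w huw)

lemma Near.mem_nonadj_sing (h : Near p L f) {u : V} (hu : u ∈ sing p) :
    f u ∈ nonadj L f T ↔ Disjoint (L u) T := by
  rw [mem_nonadj, Finset.disjoint_right]
  refine forall₂_congr fun c _ => ⟨?_, fun hcu => ⟨u, rfl, hcu⟩⟩
  rintro ⟨v, hv, hcv⟩
  rwa [eq_of_mem_sing hu (h.1 _ _ hv)] at hcv

lemma Viol.card_meet_lt (h : Viol p L f T) : (meet p L T).card + 1 ≤ T.card := by
  have hsub : (meet p L T).image f ⊆ (nonadj L f T)ᶜ := by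
    intro x hx
    obtain ⟨u, hu, rfl⟩ := mem_image.1 hx
    obtain ⟨hu1, hu2⟩ := mem_filter.1 hu
    rwa [mem_compl, h.1.mem_nonadj_sing hu1]
  have h1 := card_le_card hsub
  rw [card_image_of_injOn (h.1.injOn_sing.mono (coe_subset.2 (meet_subset p L T)))] at h1
  have h2 := card_add_card_compl (nonadj L f T)
  have h3 := h.2
  omega

lemma card_nonadj_le (hc : Crit p L) (h : Near p L f) (hT : T.Nonempty) :
    (nonadj L f T).card + (meet p L T).card ≤
      (largeNonadj p L f T).card + (sing p).card + (twoIdx p).card := by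
  have hex : ∀ x ∈ nonadj L f T, ∃ v, f v = x := fun x hx => by
    obtain ⟨c, hcT⟩ := hT
    obtain ⟨v, hv, -⟩ := mem_nonadj.1 hx c hcT
    exact ⟨v, hv⟩
  set B : Finset V := univ.filter fun v => p v ∈ twoIdx p ∧ f v ∈ nonadj L f T with hB
  have hsub : nonadj L f T ⊆ largeNonadj p L f T ∪ (sing p \ meet p L T).image f ∪ B.image f := by
    intro x hx
    obtain ⟨v, rfl⟩ := hex x hx
    simp only [mem_union]
    have := one_le_card_part hc.surj (p v)
    rcases (by omega : (part p (p v)).card = 1 ∨ (part p (p v)).card = 2 ∨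
      3 ≤ (part p (p v)).card) with h1 | h1 | h1
    · refine Or.inl (Or.inr (mem_image.2 ⟨v, mem_sdiff.2 ⟨mem_sing.2 h1, fun hv => ?_⟩, rfl⟩))
      exact (mem_filter.1 hv).2 ((h.mem_nonadj_sing (mem_sing.2 h1)).1 hx)
    · exact Or.inr (mem_image.2 ⟨v, mem_filter.2 ⟨mem_univ _, mem_twoIdx.2 h1, hx⟩, rfl⟩)
    · exact Or.inl (Or.inl (mem_filter.2 ⟨hx, v, mem_large.2 h1, rfl⟩))
  have hdisj : ∀ u w, u ≠ w → p u = p w → p u ∈ twoIdx p → f u ≠ f w := by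
    intro u w huw hp hi hf
    have h1 : f u ∈ L u := (h.2 u).resolve_right fun h' => huw (h' w hf.symm).symm
    have h2 : f w ∈ L w := (h.2 w).resolve_right fun h' => huw (h' u hf)
    exact Finset.disjoint_left.1 (hc.disjoint_of_two huw hp hi) h1 (hf ▸ h2)
  have hBT : ∀ v ∈ B, ∀ c ∈ T, c ∉ L v := by
    intro v hv c hcT
    obtain ⟨-, hi, hv⟩ := mem_filter.1 hv
    obtain ⟨w, hw, hcw⟩ := mem_nonadj.1 hv c hcT
    by_cases hwv : w = v
    · rwa [hwv] at hcw
    · exact absurd hw.symm (hdisj v w (Ne.symm hwv) (h.1 _ _ hw).symm hi)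
  have hBcard : (B.image f).card ≤ (twoIdx p).card := by
    refine card_image_le.trans (card_le_card_of_injOn p (fun v hv => (mem_filter.1 hv).2.1) ?_)
    intro u hu w hw huw
    by_contra hne
    have huniv := (hc.two_mul_le_of_disjoint
      (hc.disjoint_of_two hne huw (mem_filter.1 hu).2.1)).2
    obtain ⟨c, hcT⟩ := hT
    have hcm : c ∈ L u ∪ L w := huniv ▸ mem_univ c
    exact (mem_union.1 hcm).elim (hBT u hu c hcT) (hBT w hw c hcT)
  have h1 := card_le_card hsub
  have h2 := card_union_le (largeNonadj p L f T ∪ (sing p \ meet p L T).image f) (B.image f)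
  have h3 := card_union_le (largeNonadj p L f T) ((sing p \ meet p L T).image f)
  have h4 : ((sing p \ meet p L T).image f).card ≤ (sing p).card - (meet p L T).card := by
    refine card_image_le.trans (card_sdiff_of_subset (filter_subset _ _)).le
  have h5 : (meet p L T).card ≤ (sing p).card := card_le_card (filter_subset _ _)
  omega

lemma largeDeg_add_card_le (h : Near p L f) {c : α} (hcT : c ∈ T) :
    largeDeg p L c + (largeNonadj p L f T).card ≤ (large p).card := by
  have hsub : largeNonadj p L f T ⊆ ((large p).filter fun v => c ∉ L v).image f := by
    intro x hx
    obtain ⟨hx, v, hv, rfl⟩ := mem_filter.1 hx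
    obtain ⟨w, hw, hcw⟩ := mem_nonadj.1 hx c hcT
    refine mem_image.2 ⟨w, mem_filter.2 ⟨?_, hcw⟩, hw⟩
    rw [mem_large] at hv ⊢
    rwa [h.1 _ _ hw]
  have h1 := (card_le_card hsub).trans card_image_le
  have h2 := card_filter_add_card_filter_not (s := large p) (fun v => c ∈ L v)
  rw [largeDeg]
  omega

/-- Bound for the degree of a colour in a violator. -/
lemma Viol.largeDeg_le (hc : Crit p L) (h : Viol p L f T) {c : α} (hcT : c ∈ T) :
    largeDeg p L c + Fintype.card α + (meet p L T).card + (twoIdx p).card ≤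
      2 * Fintype.card ι + T.card := by
  have h1 := largeDeg_add_card_le h.1 hcT
  have h2 := card_nonadj_le hc h.1 ⟨c, hcT⟩
  have h3 := card_vertices hc.surj
  have h4 := hc.card_eq
  have h5 := h.2
  omega

end Count

section SafeTwo

variable {V ι α : Type*} [Fintype V] [Fintype ι] [Fintype α]
variable {p : V → ι} {L : V → Finset α}

/-- An injective system of hosts for the colours in `H` can be modified to cover all vertices
of a set `X` that injects compatibly into `H`. -/
lemma exists_injOn_cover {H : Finset α} {X : Finset V} {a : V → α} {g : α → V}
    (ha : ∀ v ∈ X, a v ∈ L v ∧ a v ∈ H) (hainj : Set.InjOn a X)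
    (hg : ∀ c ∈ H, c ∈ L (g c)) (hginj : Set.InjOn g H) :
    ∃ m : α → V, (∀ c ∈ H, c ∈ L (m c)) ∧ Set.InjOn m H ∧ X ⊆ H.image m := by
  obtain ⟨m, hm, hmax⟩ := exists_max_image
    (univ.filter fun m : α → V => (∀ c ∈ H, c ∈ L (m c)) ∧ Set.InjOn m H)
    (fun m => (X.filter fun v => m (a v) = v).card) ⟨g, mem_filter.2 ⟨mem_univ _, hg, hginj⟩⟩
  obtain ⟨-, hmL, hminj⟩ := mem_filter.1 hm
  refine ⟨m, hmL, hminj, fun v hv => ?_⟩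
  by_contra hvm
  have hvm' : ∀ c ∈ H, m c ≠ v := fun c hc h => hvm (mem_image.2 ⟨c, hc, h⟩)
  have hle := hmax (update m (a v) v) (mem_filter.2 ⟨mem_univ _, fun c hc => ?_, ?_⟩)
  · refine absurd hle (not_le.2 (card_lt_card ?_))
    rw [ssubset_iff_of_subset]
    · refine ⟨v, mem_filter.2 ⟨hv, by simp⟩, fun h => ?_⟩
      exact hvm' _ (ha v hv).2 (mem_filter.1 h).2
    · intro w hw
      obtain ⟨hwX, hw⟩ := mem_filter.1 hw
      refine mem_filter.2 ⟨hwX, ?_⟩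
      rw [update_of_ne, hw]
      intro h
      have := hainj hwX hv h
      subst this
      exact hvm' _ (ha w hv).2 hw
  · by_cases h : c = a v
    · subst h; simpa using (ha v hv).1
    · rw [update_of_ne h]; exact hmL c hc
  · intro c hc d hd hcd
    by_cases h1 : c = a v <;> by_cases h2 : d = a v
    · rw [h1, h2]
    · rw [h1, update_self, update_of_ne h2] at hcd
      exact absurd hcd.symm (hvm' d hd)
    · rw [h2, update_self, update_of_ne h1] at hcd
      exact absurd hcd (hvm' c hc)
    · rw [update_of_ne h1, update_of_ne h2] at hcd
      exact hminj hc hd hcd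

lemma Crit.exists_injOn_small (hc : Crit p L) {F : Finset α}
    (hFc : F.card = (largeIdx p).card) :
    ∃ a : V → α, (∀ v ∈ (large p)ᶜ, a v ∈ L v \ F) ∧ Set.InjOn a ((large p)ᶜ : Finset V) := by
  obtain ⟨g, -, -⟩ := hc.exists_host
  have hi := hc.le_card
  have hk := card_idx hc.surj
  have hpos := hc.card_largeIdx_pos
  have hne : ∀ v, ∃ c, c ∈ L v := fun v => card_pos.1 (by have := hi v; omega)
  choose f₀ _ using hne
  refine exists_injOn_of_hall f₀ (fun v => L v \ F) fun A hA => ?_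
  by_cases hA2 : Set.InjOn p A
  · rcases A.eq_empty_or_nonempty with rfl | ⟨v, hv⟩
    · simp
    have h1 : (A.image p).card ≤ ((largeIdx p)ᶜ).card := card_le_card fun i hi => by
      obtain ⟨u, hu, rfl⟩ := mem_image.1 hi
      have := hA hu
      rw [mem_compl, mem_large] at this
      rwa [mem_compl, mem_largeIdx]
    rw [card_image_of_injOn hA2, card_compl] at h1
    have h2 := card_le_card (subset_biUnion_of_mem (fun v => L v \ F) hv)
    have h3 := le_card_sdiff F (L v)
    have h4 := hi v
    omega
  · simp only [Set.InjOn, not_forall] at hA2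
    obtain ⟨u, hu, w, hw, huw, hne⟩ := hA2
    have hu2 : p u ∈ twoIdx p := by
      have h1 := hA hu
      rw [mem_compl, mem_large] at h1
      have h2 : 1 < (part p (p u)).card :=
        one_lt_card.2 ⟨u, mem_part.2 rfl, w, mem_part.2 huw.symm, hne⟩
      exact mem_twoIdx.2 (by omega)
    obtain ⟨hn, huniv⟩ := hc.two_mul_le_of_disjoint (hc.disjoint_of_two hne huw hu2)
    have h1 : Fᶜ ⊆ A.biUnion fun v => L v \ F := by
      intro c hcF
      have : c ∈ L u ∪ L w := huniv ▸ mem_univ c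
      rw [mem_biUnion]
      rcases mem_union.1 this with h | h
      · exact ⟨u, hu, mem_sdiff.2 ⟨h, mem_compl.1 hcF⟩⟩
      · exact ⟨w, hw, mem_sdiff.2 ⟨h, mem_compl.1 hcF⟩⟩
    have h2 := card_le_card h1
    have h3 := card_le_card hA
    rw [card_compl] at h2 h3
    have h4 := card_vertices hc.surj
    omega

lemma Crit.false_of_safe_of_card_eq (hc : Crit p L) (hn : Fintype.card α = 2 * Fintype.card ι)
    {F : Finset α} (hF : ∀ c ∈ F, ∀ f T, Viol p L f T → c ∉ T)
    (hFc : F.card = (largeIdx p).card) : False := by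
  obtain ⟨a, ha, hainj⟩ := hc.exists_injOn_small hFc
  obtain ⟨g, hg, hgL⟩ := hc.exists_host
  obtain ⟨m, hmL, hminj, hcov⟩ := exists_injOn_cover (H := Fᶜ) (X := (large p)ᶜ) (L := L)
    (fun v hv => ⟨(mem_sdiff.1 (ha v hv)).1, mem_compl.2 (mem_sdiff.1 (ha v hv)).2⟩) hainj
    (fun c _ => hgL c) hg.injOn
  set D : Finset V := Fᶜ.image m with hD
  have hpos := hc.card_largeIdx_pos
  obtain ⟨c₀, -⟩ : F.Nonempty := card_pos.1 (by omega)
  obtain ⟨f₀, hf₀⟩ : ∃ f₀ : V → α, ∀ c ∈ Fᶜ, f₀ (m c) = c :=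
    ⟨fun v => if h : ∃ c ∈ Fᶜ, m c = v then h.choose else c₀, fun c hcF => by
      have h : ∃ d ∈ Fᶜ, m d = m c := ⟨c, hcF, rfl⟩
      simp only [h, dif_pos]
      exact hminj h.choose_spec.1 hcF h.choose_spec.2⟩
  have hDm : ∀ v ∈ D, f₀ v ∈ Fᶜ ∧ m (f₀ v) = v := fun v hv => by
    obtain ⟨c, hcF, rfl⟩ := mem_image.1 hv
    rw [hf₀ c hcF]
    exact ⟨hcF, rfl⟩
  have hDL : ∀ v ∈ D, f₀ v ∈ L v := fun v hv => by
    have := hmL _ (hDm v hv).1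
    rwa [(hDm v hv).2] at this
  have hDinj : ∀ u ∈ D, ∀ w ∈ D, f₀ u = f₀ w → u = w := fun u hu w hw h => by
    rw [← (hDm u hu).2, ← (hDm w hw).2, h]
  have hDcard : D.card = Fintype.card α - F.card := by
    rw [hD, card_image_of_injOn hminj, card_compl]
  have hFle : F.card ≤ Fintype.card α := card_le_univ _
  have hRcard : Dᶜ.card = F.card + 1 := by
    rw [card_compl, hDcard, hc.card_eq]; omega
  have hRlarge : ∀ v, v ∉ D → v ∈ large p := fun v hv => by
    by_contra h
    exact hv (hcov (mem_compl.2 h))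
  -- two uncovered vertices with a common colour
  have hpair : ∀ w w', w ∉ D → w' ∉ D → w ≠ w' → p w = p w' → ∀ c, c ∈ L w → c ∉ L w' := by
    intro w w' hw hw' hne hp c hcw hcw'
    set D₁ : Finset V := D.filter fun v => f₀ v ≠ c with hD₁
    have hD₁D : D₁ ⊆ D := filter_subset _ _
    set f : V → α := fun v => if v ∈ D₁ then f₀ v else c with hf
    refine hc.false_of_cover hF (f := f) (insert w (insert w' D₁)) ?_ ?_ ?_
    · intro v hv
      by_cases h1 : v ∈ D₁
      · simpa [hf, h1] using hDL v (hD₁D h1)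
      · rcases mem_insert.1 hv with rfl | hv
        · simpa [hf, h1] using hcw
        · rcases mem_insert.1 hv with rfl | hv
          · simpa [hf, h1] using hcw'
          · exact absurd hv h1
    · have hout : ∀ v ∈ insert w (insert w' D₁), v ∉ D₁ → p v = p w := by
        intro v hv h1
        rcases mem_insert.1 hv with rfl | hv
        · rfl
        · rcases mem_insert.1 hv with rfl | hv
          · exact hp.symm
          · exact absurd hv h1
      intro u hu v hv huv
      by_cases h1 : u ∈ D₁ <;> by_cases h2 : v ∈ D₁ <;>
        simp only [hf, h1, h2, if_true, if_false] at huv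
      · rw [hDinj u (hD₁D h1) v (hD₁D h2) huv]
      · exact absurd huv (mem_filter.1 h1).2
      · exact absurd huv.symm (mem_filter.1 h2).2
      · rw [hout u hu h1, hout v hv h2]
    · have hw1 : w ∉ insert w' D₁ := by
        rw [mem_insert, not_or]; exact ⟨hne, fun h => hw (hD₁D h)⟩
      have hw2 : w' ∉ D₁ := fun h => hw' (hD₁D h)
      rw [card_compl, card_insert_of_notMem hw1, card_insert_of_notMem hw2, hc.card_eq]
      have himg : (insert w (insert w' D₁)).image f ⊆ insert c Fᶜ := by
        intro x hx
        obtain ⟨v, -, rfl⟩ := mem_image.1 hx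
        by_cases h1 : v ∈ D₁
        · simpa [hf, h1] using Or.inr (mem_compl.1 (hDm v (hD₁D h1)).1)
        · simp [hf, h1]
      have hsub : F.erase c ⊆ F \ (insert w (insert w' D₁)).image f := by
        intro x hx
        obtain ⟨hxc, hxF⟩ := mem_erase.1 hx
        refine mem_sdiff.2 ⟨hxF, fun h => ?_⟩
        rcases mem_insert.1 (himg h) with h | h
        · exact hxc h
        · exact mem_compl.1 h hxF
      have h3 := card_le_card hsub
      by_cases hcF : c ∈ F
      · have h4 : D₁ = D := filter_true_of_mem fun v hv h =>
          mem_compl.1 (hDm v hv).1 (h ▸ hcF)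
        rw [card_erase_of_mem hcF] at h3
        have h5 := congrArg card h4
        omega
      · have h4 : D ⊆ insert (m c) D₁ := fun v hv => by
          by_cases h : f₀ v = c
          · rw [← h, (hDm v hv).2]; exact mem_insert_self _ _
          · exact mem_insert_of_mem (mem_filter.2 ⟨hv, h⟩)
        have h5 := (card_le_card h4).trans (card_insert_le _ _)
        rw [erase_eq_of_notMem hcF] at h3
        omega
  -- an uncovered vertex joining the class of a covered one
  have hjoin : ∀ x v, x ∉ D → v ∈ D → p x = p v → f₀ v ∉ L x := by
    intro x v hx hv hp hL
    set f : V → α := fun u => if u ∈ D then f₀ u else f₀ v with hf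
    refine hc.false_of_cover hF (f := f) (insert x D) ?_ ?_ ?_
    · intro u hu
      rcases mem_insert.1 hu with rfl | hu
      · simpa [hf, hx] using hL
      · simpa [hf, hu] using hDL u hu
    · have key : ∀ u ∈ D, f₀ u = f₀ v → p u = p x := fun u hu h => by
        rw [hDinj u hu v hv h, hp]
      intro u hu w hw huw
      rcases mem_insert.1 hu with rfl | hu' <;> rcases mem_insert.1 hw with rfl | hw'
      · rfl
      · simp only [hf, hx, hw', if_true, if_false] at huw
        exact (key w hw' huw.symm).symm
      · simp only [hf, hx, hu', if_true, if_false] at huw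
        exact key u hu' huw
      · simp only [hf, hu', hw', if_true] at huw
        rw [hDinj u hu' w hw' huw]
    · have himg : F ⊆ F \ (insert x D).image f := by
        intro c hcF
        refine mem_sdiff.2 ⟨hcF, fun h => ?_⟩
        obtain ⟨u, -, rfl⟩ := mem_image.1 h
        by_cases hu : u ∈ D
        · simp only [hf, hu, if_true] at hcF
          exact mem_compl.1 (hDm u hu).1 hcF
        · simp only [hf, hu, if_false] at hcF
          exact mem_compl.1 (hDm v hv).1 hcF
      have h3 := card_le_card himg
      rw [card_compl, card_insert_of_notMem hx]
      rw [card_compl] at hRcard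
      omega
  obtain ⟨w, hw, w', hw', hne, hp⟩ := exists_ne_map_eq_of_card_lt_of_maps_to
    (s := Dᶜ) (t := largeIdx p) (by omega) (f := p)
    (fun v hv => mem_coe.2 (mem_largeIdx.2 (mem_large.1 (hRlarge v (mem_compl.1 hv)))))
  rw [mem_compl] at hw hw'
  have huniv := (hc.two_mul_le_of_disjoint (Finset.disjoint_left.2
    fun c h h' => hpair w w' hw hw' hne hp c h h')).2
  obtain ⟨v, hv, hvw⟩ : ∃ v ∈ part p (p w), v ∉ ({w, w'} : Finset V) := by
    refine exists_mem_notMem_of_card_lt_card ?_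
    have := mem_large.1 (hRlarge w hw)
    exact (card_le_two).trans_lt (by omega)
  rw [mem_part] at hv
  simp only [mem_insert, mem_singleton, not_or] at hvw
  have hmem : ∀ c, c ∈ L w ∨ c ∈ L w' := fun c => mem_union.1 (huniv ▸ mem_univ c)
  by_cases hvD : v ∈ D
  · rcases hmem (f₀ v) with h | h
    · exact hjoin w v hw hvD hv.symm h
    · exact hjoin w' v hw' hvD (hp.symm.trans hv.symm) h
  · obtain ⟨c, hcv⟩ : (L v).Nonempty := card_pos.1 (by
      have := hc.le_card v
      have := card_idx hc.surj
      omega)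
    rcases hmem c with h | h
    · exact hpair v w hvD hw hvw.1 hv c hcv h
    · exact hpair v w' hvD hw' hvw.2 (hv.trans hp) c hcv h

end SafeTwo

section SafeLarge

variable {V ι α : Type*} [Fintype V] [Fintype ι] [Fintype α]
variable {p : V → ι} {L : V → Finset α}

/-- A partial colouring of the large parts from the lists restricted to `H`. -/
def PartialCol (p : V → ι) (L : V → Finset α) (H : Finset α) (D : Finset V) (f : V → α) : Prop :=
  D ⊆ large p ∧ (∀ v ∈ D, f v ∈ L v ∧ f v ∈ H) ∧ ∀ u ∈ D, ∀ w ∈ D, f u = f w → p u = p w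

/-- In a maximum partial colouring, replacing the class of a colour does not increase its size. -/
lemma PartialCol.card_class_le {H : Finset α} {D : Finset V} {f : V → α}
    (h : PartialCol p L H D f) (hmax : ∀ D' f', PartialCol p L H D' f' → D'.card ≤ D.card)
    {t : α} (ht : t ∈ H) {i : ι} (hi : i ∈ largeIdx p) {M : Finset V}
    (hM : ∀ v ∈ M, p v = i ∧ t ∈ L v ∧ (v ∈ D → f v = t)) :
    M.card ≤ (D.filter fun v => f v = t).card := by
  have hdisj : Disjoint M (D.filter fun v => f v ≠ t) := by
    rw [Finset.disjoint_left]
    intro v hv hv'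
    obtain ⟨h1, h2⟩ := mem_filter.1 hv'
    exact h2 ((hM v hv).2.2 h1)
  have h1 := hmax (M ∪ D.filter fun v => f v ≠ t) (fun v => if v ∈ M then t else f v) ⟨?_, ?_, ?_⟩
  · rw [card_union_of_disjoint hdisj] at h1
    have h2 := card_filter_add_card_filter_not (s := D) (fun v => f v = t)
    simp only [ne_eq] at h1
    omega
  · intro v hv
    rcases mem_union.1 hv with hv | hv
    · rw [mem_large, (hM v hv).1]
      exact mem_largeIdx.1 hi
    · exact h.1 (mem_filter.1 hv).1
  · intro v hv
    by_cases hvM : v ∈ M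
    · simpa [hvM] using ⟨(hM v hvM).2.1, ht⟩
    · simpa [hvM] using h.2.1 v (mem_filter.1 ((mem_union.1 hv).resolve_left hvM)).1
  · intro u hu w hw huw
    by_cases h1 : u ∈ M <;> by_cases h2 : w ∈ M <;>
      simp only [h1, h2, if_true, if_false] at huw
    · rw [(hM u h1).1, (hM w h2).1]
    · exact absurd huw.symm (mem_filter.1 ((mem_union.1 hw).resolve_left h2)).2
    · exact absurd huw (mem_filter.1 ((mem_union.1 hu).resolve_left h1)).2
    · exact h.2.2 u (mem_filter.1 ((mem_union.1 hu).resolve_left h1)).1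
        w (mem_filter.1 ((mem_union.1 hw).resolve_left h2)).1 huw

lemma PartialCol.sum_card_le {H : Finset α} {D : Finset V} {f : V → α}
    (h : PartialCol p L H D f) (hmax : ∀ D' f', PartialCol p L H D' f' → D'.card ≤ D.card)
    {i : ι} (hi : i ∈ largeIdx p) {R : Finset V} (hR : ∀ v ∈ R, p v = i ∧ v ∉ D) :
    ∑ v ∈ R, (L v ∩ H).card + (D.filter fun v => p v = i).card ≤ D.card := by
  have h2 : D.card = ∑ t ∈ H, (D.filter fun v => f v = t).card :=
    card_eq_sum_card_fiberwise fun v hv => (h.2.1 v hv).2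
  have h3 : (D.filter fun v => p v = i).card =
      ∑ t ∈ H, ((D.filter fun v => p v = i).filter fun v => f v = t).card :=
    card_eq_sum_card_fiberwise fun v hv => (h.2.1 v (mem_filter.1 hv).1).2
  rw [sum_card_inter, h2, h3, ← sum_add_distrib]
  refine sum_le_sum fun t ht => ?_
  rw [← card_union_of_disjoint]
  · refine h.card_class_le hmax ht hi fun v hv => ?_
    rcases mem_union.1 hv with hv | hv
    · obtain ⟨hvR, hvt⟩ := mem_filter.1 hv
      exact ⟨(hR v hvR).1, hvt, fun hvD => absurd hvD (hR v hvR).2⟩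
    · obtain ⟨hv, hvt⟩ := mem_filter.1 hv
      obtain ⟨hvD, hvi⟩ := mem_filter.1 hv
      exact ⟨hvi, hvt ▸ (h.2.1 v hvD).1, fun _ => hvt⟩
  · rw [Finset.disjoint_left]
    intro v hv hv'
    exact (hR v (mem_filter.1 hv).1).2 (mem_filter.1 (mem_filter.1 hv').1).1

lemma Crit.false_of_safe_of_no_two (hc : Crit p L) (h2 : (twoIdx p).card = 0)
    {F : Finset α} (hF : ∀ c ∈ F, ∀ f T, Viol p L f T → c ∉ T)
    (hFc : F.card = (largeIdx p).card) : False := by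
  obtain ⟨a, ha, hainj⟩ := hc.exists_injOn_small hFc
  have hk := card_idx hc.surj
  have hV := card_vertices hc.surj
  have hVk := hc.card_eq
  have hpos := hc.card_largeIdx_pos
  have hsing : (large p)ᶜ = sing p := by
    ext v
    rw [mem_compl, mem_large, mem_sing]
    have h3 := one_le_card_part hc.surj (p v)
    have h4 : p v ∉ twoIdx p := fun h => by rw [card_eq_zero.1 h2] at h; simp at h
    rw [mem_twoIdx] at h4
    omega
  rw [hsing] at ha hainj
  have haL : ∀ v ∈ sing p, a v ∈ L v := fun v hv => (mem_sdiff.1 (ha v hv)).1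
  have haF : ∀ v ∈ sing p, a v ∉ F := fun v hv => (mem_sdiff.1 (ha v hv)).2
  have hsl : Disjoint (sing p) (large p) := by
    rw [← hsing]; exact (_root_.disjoint_compl_left)
  set A : Finset α := F ∪ (sing p).image a with hA
  have hFA : Disjoint F ((sing p).image a) := by
    rw [Finset.disjoint_right]
    intro c hcm
    obtain ⟨v, hv, rfl⟩ := mem_image.1 hcm
    exact haF v hv
  have hAcard : A.card = Fintype.card ι := by
    rw [hA, card_union_of_disjoint hFA, card_image_of_injOn hainj]
    omega
  have haA : ∀ v ∈ sing p, a v ∈ A := fun v hv => mem_union_right _ (mem_image_of_mem a hv)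
  -- a maximum partial colouring avoiding the colours in `A`
  obtain ⟨⟨D, f⟩, hDf, hmax'⟩ := exists_max_image
    (univ.filter fun x : Finset V × (V → α) => PartialCol p L Aᶜ x.1 x.2)
    (fun x => x.1.card) ⟨(∅, a), mem_filter.2 ⟨mem_univ _, by simp [PartialCol]⟩⟩
  replace hDf : PartialCol p L Aᶜ D f := (mem_filter.1 hDf).2
  have hmax : ∀ D' f', PartialCol p L Aᶜ D' f' → D'.card ≤ D.card := fun D' f' h =>
    hmax' (D', f') (mem_filter.2 ⟨mem_univ _, h⟩)
  clear hmax'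
  have hfA : ∀ v ∈ D, f v ∉ A := fun v hv => mem_compl.1 (hDf.2.1 v hv).2
  have hDs : ∀ v ∈ D, v ∉ sing p := fun v hv h => Finset.disjoint_left.1 hsl h (hDf.1 hv)
  -- colouring further uncovered vertices from `A`
  have hext : ∀ (Ω : Finset ι) (e : ι → α) (R' : Finset V), Set.InjOn e Ω → (∀ i ∈ Ω, e i ∈ A) →
      (∀ v ∈ R', p v ∈ Ω ∧ v ∈ large p ∧ v ∉ D ∧ e (p v) ∈ L v) →
      Fintype.card ι + 1 + Ω.card ≤ R'.card + D.card → False := by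
    intro Ω e R' he heA hR' hcard
    set S' : Finset V := (sing p).filter fun u => a u ∉ Ω.image e with hS'
    set f' : V → α := fun v => if v ∈ D then f v else if v ∈ sing p then a v else e (p v) with hf'
    have hf'D : ∀ v ∈ D, f' v = f v := fun v hv => by simp [hf', hv]
    have hf'S : ∀ v ∈ S', f' v = a v := fun v hv => by
      have hv' := (mem_filter.1 hv).1
      have : v ∉ D := fun h => hDs v h hv'
      simp [hf', hv', this]
    have hf'R : ∀ v ∈ R', f' v = e (p v) := fun v hv => by
      have h3 : v ∉ sing p := fun h => Finset.disjoint_left.1 hsl h (hR' v hv).2.1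
      simp [hf', h3, (hR' v hv).2.2.1]
    have hDR : Disjoint D R' := Finset.disjoint_right.2 fun v hv => (hR' v hv).2.2.1
    have hDRS : Disjoint (D ∪ R') S' := by
      rw [Finset.disjoint_right]
      intro v hv hv'
      have hvs := (mem_filter.1 hv).1
      rcases mem_union.1 hv' with h | h
      · exact hDs v h hvs
      · exact Finset.disjoint_left.1 hsl hvs (hR' v h).2.1
    have hRmem : ∀ v ∈ R', f' v ∈ Ω.image e ∧ f' v ∈ A := fun v hv => by
      rw [hf'R v hv]
      exact ⟨mem_image_of_mem e (hR' v hv).1, heA _ (hR' v hv).1⟩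
    have hSmem : ∀ v ∈ S', f' v ∉ Ω.image e ∧ f' v ∈ A := fun v hv => by
      rw [hf'S v hv]
      exact ⟨(mem_filter.1 hv).2, haA v (mem_filter.1 hv).1⟩
    have hDmem : ∀ v ∈ D, f' v ∉ A := fun v hv => by
      rw [hf'D v hv]; exact hfA v hv
    refine hc.false_of_cover hF (f := f') (D ∪ R' ∪ S') ?_ ?_ ?_
    · intro v hv
      rcases mem_union.1 hv with hv | hv
      · rcases mem_union.1 hv with hv | hv
        · rw [hf'D v hv]; exact (hDf.2.1 v hv).1
        · rw [hf'R v hv]; exact (hR' v hv).2.2.2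
      · rw [hf'S v hv]; exact haL v (mem_filter.1 hv).1
    · intro u hu w hw huw
      simp only [mem_union] at hu hw
      rcases hu with (hu | hu) | hu <;> rcases hw with (hw | hw) | hw
      · rw [hf'D u hu, hf'D w hw] at huw
        exact hDf.2.2 u hu w hw huw
      · exact absurd (huw ▸ (hRmem w hw).2) (hDmem u hu)
      · exact absurd (huw ▸ (hSmem w hw).2) (hDmem u hu)
      · exact absurd (huw ▸ (hRmem u hu).2) (hDmem w hw)
      · rw [hf'R u hu, hf'R w hw] at huw
        exact he (hR' u hu).1 (hR' w hw).1 huw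
      · exact absurd (huw ▸ (hRmem u hu).1) (hSmem w hw).1
      · exact absurd (huw ▸ (hSmem u hu).2) (hDmem w hw)
      · exact absurd (huw ▸ (hRmem w hw).1) (hSmem u hu).1
      · rw [hf'S u hu, hf'S w hw] at huw
        rw [hainj (mem_coe.2 (mem_filter.1 hu).1) (mem_coe.2 (mem_filter.1 hw).1) huw]
    · have hsub : F \ Ω.image e ⊆ F \ (D ∪ R' ∪ S').image f' := by
        intro c hcm
        obtain ⟨hcF, hce⟩ := mem_sdiff.1 hcm
        refine mem_sdiff.2 ⟨hcF, fun h => ?_⟩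
        obtain ⟨v, hv, rfl⟩ := mem_image.1 h
        rcases mem_union.1 hv with hv | hv
        · rcases mem_union.1 hv with hv | hv
          · exact hDmem v hv (mem_union_left _ hcF)
          · exact hce (hRmem v hv).1
        · rw [hf'S v hv] at hcF
          exact haF v (mem_filter.1 hv).1 hcF
      have h3 := card_le_card hsub
      have h4 : S'.card + ((Ω.image e) ∩ (sing p).image a).card ≥ (sing p).card := by
        have h5 := card_filter_add_card_filter_not (s := sing p) (fun u => a u ∈ Ω.image e)
        have h6 : ((sing p).filter fun u => a u ∈ Ω.image e).card ≤
            ((Ω.image e) ∩ (sing p).image a).card := by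
          refine card_le_card_of_injOn a (fun u hu => ?_) (hainj.mono ?_)
          · obtain ⟨hu1, hu2⟩ := mem_filter.1 hu
            exact mem_coe.2 (mem_inter.2 ⟨hu2, mem_image_of_mem a hu1⟩)
          · exact coe_subset.2 (filter_subset _ _)
        rw [hS']
        omega
      have h5 : (F ∩ Ω.image e).card + ((Ω.image e) ∩ (sing p).image a).card ≤ Ω.card := by
        rw [← card_union_of_disjoint]
        · exact (card_le_card (union_subset inter_subset_right inter_subset_left)).trans
            card_image_le
        · exact hFA.mono inter_subset_left inter_subset_right
      have h6 := card_sdiff_add_card_inter F (Ω.image e)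
      rw [card_compl, card_union_of_disjoint hDRS, card_union_of_disjoint hDR]
      omega
  obtain ⟨e₀⟩ : Nonempty (ι → α) := ⟨a ∘ surjInv hc.surj⟩
  have hDk : D.card ≤ Fintype.card ι := by
    by_contra h
    exact hext ∅ e₀ ∅ (by simp)
      (by simp) (by simp) (by simp; omega)
  -- the uncovered vertices of each part
  set R : ι → Finset V := fun i => (part p i) \ D with hR
  have hRi : ∀ i, ∀ v ∈ R i, p v = i ∧ v ∉ D := fun i v hv => by
    obtain ⟨h1, h2⟩ := mem_sdiff.1 hv
    exact ⟨mem_part.1 h1, h2⟩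
  have hRcard : ∀ i, (R i).card + (D.filter fun v => p v = i).card = (part p i).card := by
    intro i
    rw [← card_sdiff_add_card_inter (part p i) D]
    congr 2
    ext v
    simp [part, and_comm]
  have hRsum : ∑ i ∈ largeIdx p, (R i).card + D.card =
      Fintype.card ι + 1 + (largeIdx p).card := by
    have h3 : D.card = ∑ i ∈ largeIdx p, (D.filter fun v => p v = i).card :=
      card_eq_sum_card_fiberwise fun v hv => mem_largeIdx.2 (mem_large.1 (hDf.1 hv))
    have h4 := card_filter_mem (p := p) (largeIdx p)
    have h5 : (univ.filter fun v => p v ∈ largeIdx p) = large p := by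
      ext v; simp [mem_largeIdx, mem_large]
    rw [h5] at h4
    have h6 := hc.card_large
    rw [h3, ← sum_add_distrib, sum_congr rfl fun i _ => hRcard i]
    omega
  set K : ι → Finset α := fun i => A.filter fun c => ∀ v ∈ R i, c ∈ L v with hK
  have hmiss : ∀ v, (A \ L v).card ≤ (L v ∩ Aᶜ).card := fun v => by
    have h3 := hc.le_card v
    have h4 := card_sdiff_add_card_inter A (L v)
    have h5 := card_sdiff_add_card_inter (L v) A
    have h6 : L v \ A = L v ∩ Aᶜ := by ext; simp
    rw [inter_comm] at h5
    rw [← h6]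
    omega
  have hmisssum : ∀ i ∈ largeIdx p, ∑ v ∈ R i, (A \ L v).card +
      (D.filter fun v => p v = i).card ≤ D.card := fun i hi =>
    (Nat.add_le_add_right (sum_le_sum fun v _ => hmiss v) _).trans
      (hDf.sum_card_le hmax hi (hRi i))
  have hKcard : ∀ i ∈ largeIdx p, Fintype.card ι + (D.filter fun v => p v = i).card ≤
      (K i).card + D.card := by
    intro i hi
    have h3 : A ⊆ K i ∪ (R i).biUnion fun v => A \ L v := by
      intro c hcA
      by_cases h : ∀ v ∈ R i, c ∈ L v
      · exact mem_union_left _ (mem_filter.2 ⟨hcA, h⟩)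
      · push Not at h
        obtain ⟨v, hv, hcv⟩ := h
        exact mem_union_right _ (mem_biUnion.2 ⟨v, hv, mem_sdiff.2 ⟨hcA, hcv⟩⟩)
    have h4 := (card_le_card h3).trans (card_union_le _ _)
    have h5 : ((R i).biUnion fun v => A \ L v).card ≤ ∑ v ∈ R i, (A \ L v).card :=
      card_biUnion_le
    have h6 := hmisssum i hi
    omega
  have hKcard2 : ∀ i ∈ largeIdx p, (R i).card = 2 →
      Fintype.card ι + 1 ≤ (K i).card + D.card := by
    intro i hi h
    have h3 := hRcard i
    have h4 := mem_largeIdx.1 hi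
    have h5 := hKcard i hi
    omega
  -- choosing common colours for a set of parts
  have hΩ : ∀ Ω ⊆ largeIdx p, (∀ i ∈ Ω, Ω.card ≤ (K i).card) →
      Fintype.card ι + 1 + Ω.card ≤ ∑ i ∈ Ω, (R i).card + D.card → False := by
    intro Ω hΩ hKΩ hcard
    obtain ⟨e, heK, he⟩ := exists_injOn_of_hall
      e₀ (s := Ω) K
      (fun B hB => by
        rcases B.eq_empty_or_nonempty with rfl | ⟨i, hi⟩
        · simp
        · exact ((card_le_card hB).trans (hKΩ i (hB hi))).trans
            (card_le_card (subset_biUnion_of_mem K hi)))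
    refine hext Ω e (Ω.biUnion R) he (fun i hi => (mem_filter.1 (heK i hi)).1) ?_ ?_
    · intro v hv
      obtain ⟨i, hi, hvi⟩ := mem_biUnion.1 hv
      obtain ⟨rfl, hvD⟩ := hRi i v hvi
      exact ⟨hi, mem_large.2 (mem_largeIdx.1 (hΩ hi)), hvD, (mem_filter.1 (heK _ hi)).2 v hvi⟩
    · rw [card_biUnion]
      · exact hcard
      · intro i _ j _ hij
        rw [Function.onFun, Finset.disjoint_left]
        intro v hv hv'
        exact hij ((hRi i v hv).1.symm.trans (hRi j v hv').1)
  set big : Finset ι := (largeIdx p).filter fun i => 2 ≤ (R i).card with hbig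
  have hbigsub : big ⊆ largeIdx p := filter_subset _ _
  have hbigsum : Fintype.card ι + 1 + big.card ≤ ∑ i ∈ big, (R i).card + D.card := by
    have h3 := sum_filter_add_sum_filter_not (largeIdx p) (fun i => 2 ≤ (R i).card)
      (fun i => (R i).card)
    have h4 := card_filter_add_card_filter_not (s := largeIdx p) (fun i => 2 ≤ (R i).card)
    have h5 : ∑ i ∈ (largeIdx p).filter (fun i => ¬ 2 ≤ (R i).card), (R i).card ≤
        ((largeIdx p).filter (fun i => ¬ 2 ≤ (R i).card)).card • 1 :=
      sum_le_card_nsmul _ _ _ fun i hi => by have := (mem_filter.1 hi).2; omega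
    rw [smul_eq_mul, mul_one] at h5
    rw [hbig]
    omega
  by_cases hsmall : big.card + D.card ≤ Fintype.card ι
  · exact hΩ big hbigsub (fun i hi => by have := hKcard i (hbigsub hi); omega) hbigsum
  by_cases hthree : ∃ i ∈ big, 3 ≤ (R i).card
  · obtain ⟨i, hi, hi3⟩ := hthree
    by_cases hy : D.card = Fintype.card ι
    · obtain ⟨v, u, w, hv, hu, hw, hvu, hvw, huw⟩ := two_lt_card_iff.1 hi3
      have hpair : ∀ x ∈ R i, ∀ y ∈ R i, x ≠ y →
          Fintype.card ι ≤ (A \ L x).card + (A \ L y).card := by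
        intro x hx y hy' hxy
        by_contra hlt
        obtain ⟨c, hcA, hcn⟩ : ∃ c ∈ A, c ∉ (A \ L x) ∪ (A \ L y) := by
          refine exists_mem_notMem_of_card_lt_card ((card_union_le _ _).trans_lt ?_)
          omega
        simp only [mem_union, mem_sdiff, hcA, true_and, not_or, not_not] at hcn
        refine hext {i} (fun _ => c) {x, y} (by simp) (by simpa using hcA) ?_ ?_
        · intro z hz
          have hzR : z ∈ R i ∧ c ∈ L z := by
            rcases mem_insert.1 hz with rfl | hz
            · exact ⟨hx, hcn.1⟩
            · rw [mem_singleton.1 hz]; exact ⟨hy', hcn.2⟩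
          obtain ⟨hzi, hzD⟩ := hRi i z hzR.1
          refine ⟨by simp [hzi], ?_, hzD, hzR.2⟩
          rw [mem_large, hzi]
          exact mem_largeIdx.1 (hbigsub hi)
        · rw [card_pair hxy, card_singleton]; omega
      have h3 : ∑ z ∈ ({v, u, w} : Finset V), (A \ L z).card ≤ ∑ z ∈ R i, (A \ L z).card :=
        sum_le_sum_of_subset fun z hz => by
          simp only [mem_insert, mem_singleton] at hz
          rcases hz with rfl | rfl | rfl <;> assumption
      rw [sum_insert (by simp [hvu, hvw]), sum_insert (by simp [huw]), sum_singleton] at h3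
      have h4 := hmisssum i (hbigsub hi)
      have h5 := hpair v hv u hu hvu
      have h6 := hpair v hv w hw hvw
      have h7 := hpair u hu w hw huw
      omega
    · obtain ⟨Ω, hiΩ, hΩb, hΩc⟩ := exists_subsuperset_card_eq (s := {i}) (t := big)
        (n := Fintype.card ι - D.card) (by simpa using hi) (by simp; omega) (by omega)
      refine hΩ Ω (hΩb.trans hbigsub) (fun j hj => ?_) ?_
      · have := hKcard j (hbigsub (hΩb hj))
        omega
      · have hi' : i ∈ Ω := hiΩ (mem_singleton_self i)
        have h3 := add_sum_erase Ω (fun i => (R i).card) hi'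
        have h4 : (Ω.erase i).card • 2 ≤ ∑ j ∈ Ω.erase i, (R j).card :=
          card_nsmul_le_sum _ _ _ fun j hj => (mem_filter.1 (hΩb (mem_of_mem_erase hj))).2
        rw [card_erase_of_mem hi', smul_eq_mul] at h4
        omega
  · push Not at hthree
    have htwo : ∀ i ∈ big, (R i).card = 2 := fun i hi => by
      have h3 := hthree i hi
      have h4 := (mem_filter.1 hi).2
      omega
    obtain ⟨Ω, hΩb, hΩc⟩ := exists_subset_card_eq (s := big)
      (n := Fintype.card ι - D.card + 1) (by omega)
    refine hΩ Ω (hΩb.trans hbigsub) (fun j hj => ?_) ?_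
    · have := hKcard2 j (hbigsub (hΩb hj)) (htwo j (hΩb hj))
      omega
    · rw [sum_congr rfl fun j hj => htwo j (hΩb hj), sum_const, smul_eq_mul]
      omega

/-- There are fewer safe colours than large parts. -/
lemma Crit.card_safe_lt (hc : Crit p L) {F : Finset α}
    (hF : ∀ c ∈ F, ∀ f T, Viol p L f T → c ∉ T) : F.card < (largeIdx p).card := by
  by_contra h
  obtain ⟨F', hF'F, hF'⟩ := exists_subset_card_eq (not_lt.1 h)
  have hF'' : ∀ c ∈ F', ∀ f T, Viol p L f T → c ∉ T := fun c hcF => hF c (hF'F hcF)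
  by_cases h2 : (twoIdx p).card = 0
  · exact hc.false_of_safe_of_no_two h2 hF'' hF'
  · exact hc.false_of_safe_of_card_eq (hc.card_colours_of_two h2) hF'' hF'

end SafeLarge

section Safe

variable {V ι α : Type*} [Fintype V] [Fintype ι] [Fintype α]
variable {p : V → ι} {L : V → Finset α} {f : V → α} {T : Finset α}

/-- The colours contained in no violator. -/
def safe (p : V → ι) (L : V → Finset α) : Finset α := {c | ∀ f T, Viol p L f T → c ∉ T}

lemma mem_safe {c : α} : c ∈ safe p L ↔ ∀ f T, Viol p L f T → c ∉ T := by simp [safe]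

lemma exists_viol_of_notMem_safe {c : α} (hc : c ∉ safe p L) :
    ∃ f T, Viol p L f T ∧ c ∈ T := by
  rw [mem_safe] at hc
  push Not at hc
  exact hc

lemma Viol.disjoint_safe (h : Viol p L f T) : Disjoint (safe p L) T := by
  rw [Finset.disjoint_left]
  exact fun c hc => mem_safe.1 hc f T h

/-- A good colouring can be made surjective if all colours have distinct hosts. -/
lemma Good.exists_surjective (h : Good p L) {g : α → V} (hg : Injective g)
    (hgL : ∀ c, c ∈ L (g c)) :
    ∃ f : V → α, (∀ v, f v ∈ L v) ∧ (∀ u w, f u = f w → p u = p w) ∧ Surjective f := by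
  obtain ⟨f₀, hf₀⟩ := h
  obtain ⟨f, hf, hmax⟩ := exists_max_image
    (univ.filter fun f : V → α => (∀ v, f v ∈ L v) ∧ ∀ u w, f u = f w → p u = p w)
    (fun f => (univ.filter fun c => f (g c) = c).card) ⟨f₀, mem_filter.2 ⟨mem_univ _, hf₀⟩⟩
  obtain ⟨-, hfL, hfp⟩ := mem_filter.1 hf
  refine ⟨f, hfL, hfp, fun c => ?_⟩
  by_contra hc
  have hc' : ∀ v, f v ≠ c := fun v hv => hc ⟨v, hv⟩
  have hle := hmax (update f (g c) c) (mem_filter.2 ⟨mem_univ _, fun v => ?_, fun u w huw => ?_⟩)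
  · refine absurd hle (not_le.2 (card_lt_card ?_))
    rw [ssubset_iff_of_subset]
    · exact ⟨c, by simp, fun h => hc' _ (mem_filter.1 h).2⟩
    · intro d hd
      have hd' := (mem_filter.1 hd).2
      refine mem_filter.2 ⟨mem_univ _, ?_⟩
      rw [update_of_ne, hd']
      intro h
      rw [hg h] at hd'
      exact hc' _ hd'
  · by_cases h : v = g c
    · subst h; simpa using hgL c
    · rw [update_of_ne h]; exact hfL v
  · by_cases h1 : u = g c <;> by_cases h2 : w = g c
    · rw [h1, h2]
    · rw [h1, update_self, update_of_ne h2] at huw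
      exact absurd huw.symm (hc' w)
    · rw [h2, update_self, update_of_ne h1] at huw
      exact absurd huw (hc' u)
    · rw [update_of_ne h1, update_of_ne h2] at huw
      exact hfp u w huw

/-- The classes of `f` with more than one vertex. -/
def multi (f : V → α) : Finset α := {x | 1 < (univ.filter fun v => f v = x).card}

/-- Adding a missing colour to the list of a singleton part gives a surjective near colouring
using one colour outside the lists. -/
lemma Crit.exists_state (hc : Crit p L) {u : V} (hu : u ∈ sing p) {c : α} (huc : c ∉ L u) :
    ∃ f : V → α, Near p L f ∧ (∀ T, Viol p L f T → c ∈ T) ∧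
      (multi f).card + Fintype.card α ≤ 2 * Fintype.card ι + 1 ∧
      ∀ T, (nonadj L f T).card + T.card ≤ Fintype.card α + 1 := by
  obtain ⟨g, hg, hgL⟩ := hc.exists_host
  obtain ⟨f, hfL, hfp, hsurj⟩ := (hc.maximal u c huc).exists_surjective hg fun d => by
    by_cases h : g d = u
    · rw [h, update_self]; exact mem_insert_of_mem (h ▸ hgL d)
    · rw [update_of_ne h]; exact hgL d
  have hfL' : ∀ v, v ≠ u → f v ∈ L v := fun v hv => by
    have := hfL v
    rwa [update_of_ne hv] at this
  have hfu : f u = c := by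
    have h1 := hfL u
    rw [update_self] at h1
    refine (mem_insert.1 h1).resolve_right fun h2 => hc.not_good ⟨f, fun v => ?_, hfp⟩
    by_cases hv : v = u
    · rwa [hv]
    · exact hfL' v hv
  have hnear : Near p L f := by
    refine ⟨hfp, fun v => ?_⟩
    by_cases hv : v = u
    · subst hv
      exact Or.inr fun w hw => eq_of_mem_sing hu (hfp _ _ hw)
    · exact Or.inl (hfL' v hv)
  refine ⟨f, hnear, fun T hT => ?_, ?_, fun T => ?_⟩
  · obtain ⟨w, hwT, hwL, -⟩ := hT.exists_mem
    have : w = u := by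
      by_contra h
      exact hwL (hfL' w h)
    rwa [this, hfu] at hwT
  · have h1 : Fintype.card V = ∑ x : α, (univ.filter fun v => f v = x).card :=
      card_eq_sum_card_fiberwise fun v _ => mem_coe.2 (mem_univ _)
    have h2 : ∑ x : α, (1 + if x ∈ multi f then 1 else 0) ≤
        ∑ x : α, (univ.filter fun v => f v = x).card := by
      refine sum_le_sum fun x _ => ?_
      have h3 : 0 < (univ.filter fun v => f v = x).card := by
        obtain ⟨v, hv⟩ := hsurj x
        exact card_pos.2 ⟨v, by simpa using hv⟩
      split_ifs with h
      · have := (mem_filter.1 h).2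
        omega
      · omega
    rw [sum_add_distrib, sum_boole] at h2
    simp only [sum_const, smul_eq_mul, mul_one, card_univ, filter_mem_eq_inter, univ_inter,
      Nat.cast_id] at h2
    have h3 := hc.card_eq
    omega
  · have hsub : nonadj L f T ⊆ insert c Tᶜ := by
      intro x hx
      rw [mem_insert, mem_compl]
      by_contra! hxc
      obtain ⟨v, hv, hvx⟩ := mem_nonadj.1 hx x hxc.2
      have hvu : v ≠ u := by
        rintro rfl
        exact hxc.1 (hv.symm.trans hfu)
      exact hvx (hv ▸ hfL' v hvu)
    have h1 := (card_le_card hsub).trans (card_insert_le _ _)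
    have h2 := card_add_card_compl T
    omega

lemma Crit.safe_subset (hc : Crit p L) {u : V} (hu : u ∈ sing p) : safe p L ⊆ L u := by
  intro c hcs
  by_contra huc
  obtain ⟨f, hf, hfc, -⟩ := hc.exists_state hu huc
  obtain ⟨T, hT⟩ := hc.exists_viol hf
  exact mem_safe.1 hcs f T hT (hfc T hT)

lemma Crit.largeDeg_le (hc : Crit p L) (c : α) :
    largeDeg p L c ≤ (sing p).card + (largeIdx p).card + 1 := by
  have h1 := card_filter_add_card_filter_not (s := large p) (fun v => c ∈ L v)
  have h2 : (largeIdx p).card ≤ ((large p).filter fun v => c ∉ L v).card := by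
    refine (card_le_card (t := ((large p).filter fun v => c ∉ L v).image p)
      fun i hi => ?_).trans card_image_le
    have h3 := hc.no_common c i
    have h4 := mem_largeIdx.1 hi
    obtain ⟨v, rfl, hv⟩ : ∃ v, p v = i ∧ c ∉ L v := by
      by_contra! h
      have := h3 h
      omega
    exact mem_image_of_mem p (mem_filter.2 ⟨mem_large.2 h4, hv⟩)
  have h3 := hc.card_large
  rw [largeDeg]
  omega

lemma singDeg_le (c : α) : singDeg p L c ≤ (sing p).card := card_le_card (filter_subset _ _)

lemma Viol.deg_le (hc : Crit p L) (h : Viol p L f T) {c : α} (hcT : c ∈ T) :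
    singDeg p L c + largeDeg p L c + Fintype.card α + (twoIdx p).card ≤
      2 * Fintype.card ι + T.card := by
  have h1 := h.largeDeg_le hc hcT
  have h2 := singDeg_le_card_meet (p := p) (L := L) hcT
  omega

lemma Crit.deg_le_of_notMem_safe (hc : Crit p L) {c : α} (hcs : c ∉ safe p L) :
    singDeg p L c + largeDeg p L c + (twoIdx p).card ≤ Fintype.card ι := by
  obtain ⟨f, T, h, hcT⟩ := exists_viol_of_notMem_safe hcs
  have h1 := h.deg_le hc hcT
  have h2 := h.card_add_le hc
  omega

/-- Bound for the total degree of a set of colours. -/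
lemma Crit.sum_deg_le (hc : Crit p L) {m : ℕ}
    (hm : ∀ c ∉ safe p L, singDeg p L c + largeDeg p L c ≤ m) {B : Finset α}
    (hB : safe p L ⊆ B) :
    ∑ c ∈ B, (singDeg p L c + largeDeg p L c) ≤
      (safe p L).card * (2 * (sing p).card + (largeIdx p).card + 1) +
        (B.card - (safe p L).card) * m := by
  rw [← sum_sdiff hB, add_comm, ← card_sdiff_of_subset hB]
  refine Nat.add_le_add ?_ ?_
  · refine sum_le_card_nsmul _ _ _ fun c _ => ?_
    have h1 := singDeg_le (p := p) (L := L) c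
    have h2 := hc.largeDeg_le c
    omega
  · exact sum_le_card_nsmul _ _ _ fun c hcB => hm c (mem_sdiff.1 hcB).2

lemma Crit.count (hc : Crit p L) {m : ℕ}
    (hm : ∀ c ∉ safe p L, singDeg p L c + largeDeg p L c ≤ m) :
    (Fintype.card ι : ℤ) * ((large p).card + (sing p).card) ≤
      (safe p L).card * (2 * (sing p).card + (largeIdx p).card + 1) +
        (Fintype.card α - (safe p L).card) * m := by
  have h1 := hc.sum_deg_le hm (subset_univ _)
  have h2 : ∑ c, (singDeg p L c + largeDeg p L c) =
      ∑ v ∈ sing p, (L v).card + ∑ v ∈ large p, (L v).card := by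
    have h3 := sum_card_inter L (sing p) univ
    have h4 := sum_card_inter L (large p) univ
    simp only [inter_univ] at h3 h4
    rw [sum_add_distrib, h3, h4]
    rfl
  have h3 : (sing p).card • Fintype.card ι ≤ ∑ v ∈ sing p, (L v).card :=
    card_nsmul_le_sum _ _ _ fun v _ => hc.le_card v
  have h4 : (large p).card • Fintype.card ι ≤ ∑ v ∈ large p, (L v).card :=
    card_nsmul_le_sum _ _ _ fun v _ => hc.le_card v
  rw [smul_eq_mul] at h3 h4
  have h5 : (safe p L).card ≤ Fintype.card α := card_le_univ _
  rw [card_univ] at h1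
  zify [h5] at h1 h2 h3 h4
  linarith

lemma Viol.count (hc : Crit p L) (h : Viol p L f T) {m : ℕ}
    (hm : ∀ c ∉ safe p L, singDeg p L c + largeDeg p L c ≤ m) :
    (Fintype.card ι : ℤ) * ((large p).card + (sing p).card - (meet p L T).card) +
        (safe p L).card * (meet p L T).card ≤
      (safe p L).card * (2 * (sing p).card + (largeIdx p).card + 1) +
        (Fintype.card α - T.card - (safe p L).card) * m +
        T.card * (2 * Fintype.card ι + T.card - Fintype.card α - (meet p L T).card -
          (twoIdx p).card) := by
  have hsub : safe p L ⊆ Tᶜ := fun c hcs => mem_compl.2 (Finset.disjoint_left.1 h.disjoint_safe hcs)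
  have h1 := hc.sum_deg_le hm hsub
  have h2 : ∑ c ∈ Tᶜ, (singDeg p L c + largeDeg p L c) =
      ∑ v ∈ sing p, (L v ∩ Tᶜ).card + ∑ v ∈ large p, (L v ∩ Tᶜ).card := by
    rw [sum_add_distrib, sum_card_inter, sum_card_inter]
    rfl
  have h3 : ∑ c ∈ T, largeDeg p L c = ∑ v ∈ large p, (L v ∩ T).card := by
    rw [sum_card_inter]
    rfl
  have h4 : ∑ c ∈ T, largeDeg p L c ≤ T.card •
      (2 * Fintype.card ι + T.card - (Fintype.card α + (meet p L T).card + (twoIdx p).card)) :=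
    sum_le_card_nsmul _ _ _ fun c hcT => by
      have := h.largeDeg_le hc hcT
      omega
  have h5 : (large p).card • Fintype.card ι ≤
      ∑ v ∈ large p, (L v ∩ T).card + ∑ v ∈ large p, (L v ∩ Tᶜ).card := by
    rw [← sum_add_distrib]
    refine card_nsmul_le_sum _ _ _ fun v _ => ?_
    rw [add_comm, ← sdiff_eq_inter_compl, card_sdiff_add_card_inter]
    exact hc.le_card v
  have h6 : (sing p \ meet p L T).card • Fintype.card ι + (meet p L T).card • (safe p L).card ≤
      ∑ v ∈ sing p, (L v ∩ Tᶜ).card := by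
    rw [← sum_sdiff (meet_subset p L T)]
    refine Nat.add_le_add (card_nsmul_le_sum _ _ _ fun v hv => ?_)
      (card_nsmul_le_sum _ _ _ fun v hv => ?_)
    · obtain ⟨hv1, hv2⟩ := mem_sdiff.1 hv
      have : Disjoint (L v) T := by
        by_contra h'
        exact hv2 (mem_filter.2 ⟨hv1, h'⟩)
      rw [← sdiff_eq_inter_compl, sdiff_eq_self_of_disjoint this]
      exact hc.le_card v
    · exact card_le_card (subset_inter (hc.safe_subset (meet_subset p L T hv)) hsub)
  have h7 : Fintype.card α + (meet p L T).card + (twoIdx p).card ≤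
      2 * Fintype.card ι + T.card := by
    obtain ⟨c, hcT⟩ := h.nonempty
    have := h.largeDeg_le hc hcT
    omega
  have h8 : (meet p L T).card ≤ (sing p).card := card_le_card (meet_subset p L T)
  have h9 : T.card ≤ Fintype.card α := card_le_univ _
  have h10 : (safe p L).card ≤ Fintype.card α - T.card := by
    rw [← card_compl]; exact card_le_card hsub
  rw [card_sdiff_of_subset (meet_subset p L T)] at h6
  rw [card_compl] at h1
  simp only [smul_eq_mul] at h4 h5 h6
  zify [h7, h8, h9, h10] at h1 h2 h3 h4 h5 h6
  linarith

end Safe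

section Merge

/-- The arithmetic behind the bound on the number of singleton parts meeting a violator. -/
lemma meet_bound_arith {s q q₂ n φ τ σ m : ℤ} (hq₂ : 0 ≤ q₂) (hφ : 0 ≤ φ) (hσ : 0 ≤ σ)
    (hφq : φ + 1 ≤ q) (hqs : q ≤ s + 1) (hn : n ≤ 2 * (s + q₂ + q))
    (hz : q₂ = 0 ∨ n = 2 * (s + q₂ + q)) (hτ : τ + (s + q₂ + q) ≤ n) (hστ : σ + 1 ≤ τ)
    (hm : m ≤ s + q)
    (h₁ : (s + q₂ + q) * (s + 2 * q + 1 + s) ≤ φ * (2 * s + q + 1) + (n - φ) * m)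
    (h₂ : (s + q₂ + q) * (s + 2 * q + 1 + s - σ) + φ * σ ≤
      φ * (2 * s + q + 1) + (n - τ - φ) * m + τ * (2 * (s + q₂ + q) + τ - n - σ - q₂)) :
    σ + 2 * (s + q₂ + q) + 2 + q ≤ n + m := by
  obtain ⟨l, rfl⟩ : ∃ l, n = 2 * (s + q₂ + q) + 1 - l := ⟨2 * (s + q₂ + q) + 1 - n, by ring⟩
  obtain ⟨J, rfl⟩ : ∃ J, m = s + q - J := ⟨s + q - m, by ring⟩
  have hl : 1 ≤ l := by linarith
  have hJ : 0 ≤ J := by linarith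
  have hz' : q₂ * (l - 1) = 0 := by
    rcases hz with h | h
    · rw [h, zero_mul]
    · rw [show l = 1 by linarith]; ring
  have hs : 0 ≤ s := by linarith
  have e₁ : (s + q₂ + q) * l ≤ φ * (s + 1) := by
    have : 0 ≤ J * (2 * (s + q₂ + q) + 1 - l - φ) := mul_nonneg hJ (by linarith)
    linarith
  have hφl : l ≤ φ := by
    by_contra h
    have h3 : 0 ≤ (q₂ + q - 1) * l := mul_nonneg (by linarith) (by linarith)
    have h4 : 0 ≤ (l - φ - 1) * (s + 1) := mul_nonneg (by linarith) (by linarith)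
    linarith
  have e₂ : (s + q₂ + q) * l + J * (s + q₂ + q - φ) + σ * (φ + 1 - l) ≤ φ * (s + 1) := by
    have h3 : 0 ≤ (τ - σ) * (s + q₂ + q + 1 - l - τ) := mul_nonneg (by linarith) (by linarith)
    have h4 : 0 ≤ J * (s + q₂ + q + 1 - l - τ) := mul_nonneg hJ (by linarith)
    linarith
  by_contra hcon
  have h3 : 0 ≤ (σ - (s - l - J)) * (φ + 1 - l) := mul_nonneg (by linarith) (by linarith)
  have h4 : 0 ≤ (q - φ - 1) * l := mul_nonneg (by linarith) (by linarith)
  have h5 : 0 ≤ J * (s + q₂ + q - 2 * φ) := mul_nonneg hJ (by linarith)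
  have h6 : 0 ≤ (l - 1) * (l + J) := mul_nonneg (by linarith) (by linarith)
  have h7 : 0 ≤ q₂ * l := mul_nonneg hq₂ (by linarith)
  linarith

variable {V ι α : Type*} [Fintype V] [Fintype ι] [Fintype α]
variable {p : V → ι} {L : V → Finset α} {f : V → α} {T : Finset α}

lemma Viol.card_meet_le (hc : Crit p L) (h : Viol p L f T) {m : ℕ}
    (hm : ∀ c ∉ safe p L, singDeg p L c + largeDeg p L c ≤ m)
    (hmκ : m ≤ (sing p).card + (largeIdx p).card) :
    (meet p L T).card + 2 * Fintype.card ι + 2 + (largeIdx p).card ≤ Fintype.card α + m := by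
  have hk := card_idx hc.surj
  have hl := hc.card_large
  have h1 := hc.count hm
  have h2 := h.count hc hm
  have h3 : (safe p L).card < (largeIdx p).card := hc.card_safe_lt fun c => mem_safe.1
  have h4 := hc.card_largeIdx_le
  have h5 := hc.card_colours_le
  have h6 := h.card_add_le hc
  have h7 := h.card_meet_lt
  have h8 : (twoIdx p).card = 0 ∨ Fintype.card α = 2 * Fintype.card ι := by
    by_cases h : (twoIdx p).card = 0
    · exact Or.inl h
    · exact Or.inr (hc.card_colours_of_two h)
  rw [hl] at h1 h2
  rw [hk] at h1 h2 h5 h6 h8 ⊢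
  zify at h1 h2 h3 h4 h5 h6 h7 h8 hmκ ⊢
  exact meet_bound_arith (by positivity) (by positivity) (by positivity) h3 h4 h5 h8 h6 h7 hmκ h1 h2

lemma mem_multi {x : α} : x ∈ multi f ↔ ∃ u v, u ≠ v ∧ f u = x ∧ f v = x := by
  simp only [multi, mem_filter, mem_univ, true_and, one_lt_card]
  constructor
  · rintro ⟨u, hu, v, hv, huv⟩
    exact ⟨u, v, huv, hu, hv⟩
  · rintro ⟨u, v, huv, hu, hv⟩
    exact ⟨u, hu, v, hv, huv⟩

/-- Merging two singleton classes inside a part. -/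
lemma Near.exists_merge (hf : Near p L f) {w w' : V} (hne : w ≠ w') (hp : p w = p w')
    (hw : f w ∉ multi f) (hw' : f w' ∉ multi f) {d : α} (hdw : d ∈ L w) (hdw' : d ∈ L w')
    (hd : d ∉ multi f) :
    ∃ f' : V → α, Near p L f' ∧ (multi f').card ≤ (multi f).card + 1 ∧
      (∀ T : Finset α, T.Nonempty →
        (nonadj L f' T).card ≤ (nonadj L f T \ {f w, f w'}).card + 1) ∧
      ∀ T, Disjoint (L w) T →
        (nonadj L f T \ {f w, f w'}).card + 1 ≤ (nonadj L f' T).card := by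
  have hsw : ∀ v, f v = f w → v = w := fun v hv => by
    by_contra h
    exact hw (mem_multi.2 ⟨v, w, h, hv, rfl⟩)
  have hsw' : ∀ v, f v = f w' → v = w' := fun v hv => by
    by_contra h
    exact hw' (mem_multi.2 ⟨v, w', h, hv, rfl⟩)
  set e : Equiv.Perm α := Equiv.swap (f w) d with he
  set f' : V → α := update (fun v => e (f v)) w' d with hf'
  have hfw' : f' w' = d := by simp [hf']
  have hfv : ∀ v, v ≠ w' → f' v = e (f v) := fun v hv => by simp [hf', hv]
  have hew : e (f w) = d := Equiv.swap_apply_left _ _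
  have hfw : f' w = d := by rw [hfv w hne, hew]
  have hclass : ∀ v, f' v = d → v = w ∨ v = w' := fun v hv => by
    by_cases h : v = w'
    · exact Or.inr h
    · rw [hfv v h, ← hew] at hv
      exact Or.inl (hsw v (e.injective hv))
  have hother : ∀ u v, f' u = f' v → f' v ≠ d → f u = f v ∧ u ≠ w' ∧ v ≠ w' := by
    intro u v huv hvd
    have hv : v ≠ w' := fun h => hvd (h ▸ hfw')
    have hu : u ≠ w' := fun h => hvd (huv ▸ h ▸ hfw')
    rw [hfv u hu, hfv v hv] at huv
    exact ⟨e.injective huv, hu, hv⟩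
  have hemulti : ∀ x ∈ multi f, e x = x := fun x hx =>
    Equiv.swap_apply_of_ne_of_ne (fun h => hw (h ▸ hx)) (fun h => hd (h ▸ hx))
  refine ⟨f', ⟨fun u v huv => ?_, fun v => ?_⟩, ?_, fun T hT => ?_, fun T hT => ?_⟩
  · by_cases hvd : f' v = d
    · have hpw : ∀ x, f' x = d → p x = p w := fun x hx => by
        rcases hclass x hx with rfl | rfl
        · rfl
        · exact hp.symm
      rw [hpw u (huv.trans hvd), hpw v hvd]
    · exact hf.1 u v (hother u v huv hvd).1
  · by_cases hvd : f' v = d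
    · rw [hvd]
      rcases hclass v hvd with rfl | rfl
      · exact Or.inl hdw
      · exact Or.inl hdw'
    · have hvw' : v ≠ w' := fun h => hvd (h ▸ hfw')
      by_cases hm : f v ∈ multi f
      · left
        rw [hfv v hvw', hemulti _ hm]
        refine (hf.2 v).resolve_right fun h => ?_
        obtain ⟨x, y, hxy, hx, hy⟩ := mem_multi.1 hm
        exact hxy ((h x hx).trans (h y hy).symm)
      · right
        intro u huv
        by_contra huv'
        exact hm (mem_multi.2 ⟨u, v, huv', (hother u v huv hvd).1, rfl⟩)
  · refine (card_le_card (t := insert d (multi f)) fun x hx => ?_).trans (card_insert_le _ _)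
    obtain ⟨u, v, huv, hu, hv⟩ := mem_multi.1 hx
    by_cases hxd : x = d
    · exact hxd ▸ mem_insert_self _ _
    · obtain ⟨h1, -, h2⟩ := hother u v (hu.trans hv.symm) (hv ▸ hxd)
      have h3 : f v ∈ multi f := mem_multi.2 ⟨u, v, huv, h1, rfl⟩
      rw [← hv, hfv v h2, hemulti _ h3]
      exact mem_insert_of_mem h3
  · refine (card_le_card (t := insert d ((nonadj L f T \ {f w, f w'}).image e))
      fun x hx => ?_).trans ((card_insert_le _ _).trans (Nat.add_le_add_right card_image_le 1))
    by_cases hxd : x = d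
    · exact hxd ▸ mem_insert_self _ _
    · obtain ⟨c, hcT⟩ := hT
      obtain ⟨v, rfl, -⟩ := mem_nonadj.1 hx c hcT
      have hvw' : v ≠ w' := fun h => hxd (h ▸ hfw')
      have hvw : v ≠ w := fun h => hxd (h ▸ hfw)
      refine mem_insert_of_mem (mem_image.2 ⟨f v, mem_sdiff.2 ⟨mem_nonadj.2 fun c hcT => ?_, ?_⟩,
        (hfv v hvw').symm⟩)
      · obtain ⟨u, hu, hcu⟩ := mem_nonadj.1 hx c hcT
        exact ⟨u, (hother u v hu hxd).1, hcu⟩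
      · simp only [mem_insert, mem_singleton, not_or]
        exact ⟨fun h => hvw (hsw v h), fun h => hvw' (hsw' v h)⟩
  · have hnot : d ∉ (nonadj L f T \ {f w, f w'}).image e := by
      intro h
      obtain ⟨y, hy, hyd⟩ := mem_image.1 h
      rw [← hew] at hyd
      have := (mem_sdiff.1 hy).2
      rw [e.injective hyd] at this
      simp at this
    rw [← card_image_of_injective _ e.injective, ← card_insert_of_notMem hnot]
    refine card_le_card fun x hx => mem_nonadj.2 fun c hcT => ?_
    rcases mem_insert.1 hx with rfl | hx
    · exact ⟨w, hfw, fun h => Finset.disjoint_left.1 hT h hcT⟩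
    · obtain ⟨y, hy, rfl⟩ := mem_image.1 hx
      obtain ⟨hy1, hy2⟩ := mem_sdiff.1 hy
      obtain ⟨v, hv, hcv⟩ := mem_nonadj.1 hy1 c hcT
      refine ⟨v, ?_, hcv⟩
      rw [hfv v, hv]
      rintro rfl
      rw [← hv] at hy2
      simp at hy2

end Merge

section Final

variable {V ι α : Type*} [Fintype V] [Fintype ι] [Fintype α]
variable {p : V → ι} {L : V → Finset α} {f : V → α} {T : Finset α} {m : ℕ}

lemma Viol.disjoint_mul_le (hc : Crit p L) (h : Viol p L f T) {a : ℕ}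
    (ha : ∀ c ∉ safe p L, singDeg p L c ≤ a) :
    ((sing p).card - (meet p L T).card) * (Fintype.card ι - (safe p L).card) ≤
      (Fintype.card α - T.card - (safe p L).card) * a := by
  have hcard : (Tᶜ \ safe p L).card = Fintype.card α - T.card - (safe p L).card := by
    rw [card_sdiff_of_subset, card_compl]
    exact fun c hcs => mem_compl.2 (Finset.disjoint_left.1 h.disjoint_safe hcs)
  rw [← card_sdiff_of_subset (meet_subset p L T), ← hcard, ← smul_eq_mul, ← smul_eq_mul]
  calc _ ≤ ∑ u ∈ sing p \ meet p L T, (L u ∩ (Tᶜ \ safe p L)).card := by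
        refine card_nsmul_le_sum _ _ _ fun u hu => ?_
        obtain ⟨hu1, hu2⟩ := mem_sdiff.1 hu
        have hd : Disjoint (L u) T := by
          by_contra hd
          exact hu2 (mem_filter.2 ⟨hu1, hd⟩)
        have heq : L u ∩ (Tᶜ \ safe p L) = L u \ safe p L := by
          ext c
          simp only [mem_inter, mem_sdiff, mem_compl]
          exact ⟨fun h => ⟨h.1, h.2.2⟩, fun h => ⟨h.1, Finset.disjoint_left.1 hd h.1, h.2⟩⟩
        rw [heq, card_sdiff_of_subset (hc.safe_subset hu1)]
        exact Nat.sub_le_sub_right (hc.le_card u) _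
    _ ≤ _ := by
        rw [sum_card_inter]
        refine sum_le_card_nsmul _ _ _ fun c hcT => ?_
        exact (card_le_card (filter_subset_filter _ sdiff_subset)).trans
          (ha c (mem_sdiff.1 hcT).2)

/-- A violator of small size meets many singleton parts. -/
lemma Viol.le_card_meet (hc : Crit p L) (h : Viol p L f T)
    (hm : ∀ c ∉ safe p L, singDeg p L c + largeDeg p L c ≤ m)
    (hmκ : m ≤ (sing p).card + (largeIdx p).card) :
    3 * Fintype.card ι + T.card + (sing p).card + (largeIdx p).card + 2 ≤
      (meet p L T).card + 2 * Fintype.card α + m := by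
  have hk := card_idx hc.surj
  have h3 : (safe p L).card < (largeIdx p).card := hc.card_safe_lt fun c => mem_safe.1
  have h5 := hc.card_colours_le
  have h6 := h.card_add_le hc
  have h7 := h.card_meet_le hc hm hmκ
  have h8 := card_le_card (meet_subset p L T)
  obtain ⟨a, ha⟩ : ∃ a, Fintype.card α + m = 2 * Fintype.card ι + 2 + (largeIdx p).card + a :=
    ⟨Fintype.card α + m - (2 * Fintype.card ι + 2 + (largeIdx p).card), by omega⟩
  have h9 := h.disjoint_mul_le hc (a := a) fun c hcs => by
    obtain ⟨f', T', h', hcT'⟩ := exists_viol_of_notMem_safe hcs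
    have := h'.card_meet_le hc hm hmκ
    have := singDeg_le_card_meet (p := p) (L := L) hcT'
    omega
  by_contra hcon
  obtain ⟨d, hd⟩ : ∃ d, Fintype.card ι = (safe p L).card + d :=
    ⟨Fintype.card ι - (safe p L).card, by omega⟩
  obtain ⟨j, hj⟩ : ∃ j, Fintype.card α = Fintype.card ι + T.card + j :=
    ⟨Fintype.card α - Fintype.card ι - T.card, by omega⟩
  rw [show Fintype.card ι - (safe p L).card = d by omega,
    show Fintype.card α - T.card - (safe p L).card = j + d by omega] at h9
  have h10 : a + 1 + j ≤ (sing p).card - (meet p L T).card := by omega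
  have h11 := (Nat.mul_le_mul_right d h10).trans h9
  have h12 : a + 1 ≤ d := by omega
  nlinarith [Nat.mul_le_mul_left j h12]

/-- A near colouring for which `T` is a violator of the least possible excess, with few
repeated colours. -/
structure Tight (p : V → ι) (L : V → Finset α) (m : ℕ) (f : V → α) (T : Finset α) : Prop where
  near : Near p L f
  card_eq : (nonadj L f T).card + T.card = Fintype.card α + 1
  card_le : ∀ T', (nonadj L f T').card + T'.card ≤ Fintype.card α + 1
  multi_le : (multi f).card + 2 * Fintype.card α + m ≤
    3 * Fintype.card ι + 1 + (sing p).card + (largeIdx p).card + T.card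

lemma Tight.viol (h : Tight p L m f T) : Viol p L f T := ⟨h.near, h.card_eq.ge⟩

lemma disjoint_of_mem_nonadj {v : V} (h : f v ∈ nonadj L f T) (hv : f v ∉ multi f) :
    Disjoint (L v) T := by
  rw [Finset.disjoint_right]
  intro c hcT
  obtain ⟨u, hu, hcu⟩ := mem_nonadj.1 h c hcT
  obtain rfl : u = v := by
    by_contra huv
    exact hv (mem_multi.2 ⟨u, v, huv, hu, rfl⟩)
  exact hcu

lemma Tight.exists_pair (hc : Crit p L) (h : Tight p L m f T)
    (hm : ∀ c ∉ safe p L, singDeg p L c + largeDeg p L c ≤ m)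
    (hmκ : m ≤ (sing p).card + (largeIdx p).card) :
    ∃ w w', w ≠ w' ∧ p w = p w' ∧ f w ∈ nonadj L f T ∧ f w' ∈ nonadj L f T ∧
      f w ∉ multi f ∧ f w' ∉ multi f ∧ Disjoint (L w) T ∧
      ∃ d ∈ L w, d ∈ L w' ∧ d ∉ multi f := by
  have hk := card_idx hc.surj
  have h1 := h.viol.le_card_meet hc hm hmκ
  have h2 := card_nonadj_le hc h.near h.viol.nonempty
  have h3 := h.viol.card_meet_le hc hm hmκ
  have h4 := h.card_eq
  have h5 := h.multi_le
  have h0 := h.viol.card_add_le hc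
  set Z : Finset V := (large p).filter fun v => f v ∈ nonadj L f T ∧ f v ∉ multi f with hZ
  have h6 : (largeNonadj p L f T).card ≤ Z.card + (multi f).card := by
    have : largeNonadj p L f T ⊆ Z.image f ∪ multi f := by
      intro x hx
      obtain ⟨hx, v, hv, rfl⟩ := mem_filter.1 hx
      by_cases hxm : f v ∈ multi f
      · exact mem_union_right _ hxm
      · exact mem_union_left _ (mem_image_of_mem _ (mem_filter.2 ⟨hv, hx, hxm⟩))
    have h7 := (card_le_card this).trans (card_union_le _ _)
    have h8 : (Z.image f).card ≤ Z.card := card_image_le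
    omega
  obtain ⟨w, hw, w', hw', hne, hp⟩ := exists_ne_map_eq_of_card_lt_of_maps_to
    (s := Z) (t := largeIdx p) (f := p) (by omega)
    fun v hv => mem_largeIdx.2 (mem_large.1 (mem_filter.1 hv).1)
  obtain ⟨-, hw1, hw2⟩ := mem_filter.1 hw
  obtain ⟨-, hw1', hw2'⟩ := mem_filter.1 hw'
  have hd := disjoint_of_mem_nonadj hw1 hw2
  have hd' := disjoint_of_mem_nonadj hw1' hw2'
  refine ⟨w, w', hne, hp, hw1, hw1', hw2, hw2', hd, ?_⟩
  have h7 := card_union_add_card_inter (L w) (L w')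
  have h8 : (L w ∪ L w').card + T.card ≤ Fintype.card α := by
    rw [← card_union_of_disjoint (disjoint_union_left.2 ⟨hd, hd'⟩)]
    exact card_le_univ _
  have h9 := hc.le_card w
  have h10 := hc.le_card w'
  obtain ⟨d, hd1, hd2⟩ := exists_mem_notMem_of_card_lt_card
    (s := multi f) (t := L w ∩ L w') (by omega)
  exact ⟨d, (mem_inter.1 hd1).1, (mem_inter.1 hd1).2, hd2⟩

lemma Tight.exists_larger (hc : Crit p L) (h : Tight p L m f T)
    (hm : ∀ c ∉ safe p L, singDeg p L c + largeDeg p L c ≤ m)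
    (hmκ : m ≤ (sing p).card + (largeIdx p).card) :
    ∃ f' T', Tight p L m f' T' ∧ T.card < T'.card := by
  by_contra hmax
  push Not at hmax
  obtain ⟨w, w', hne, hp, hw, hw', hwm, hwm', hd, d, hdw, hdw', hdm⟩ := h.exists_pair hc hm hmκ
  obtain ⟨f', hf', hmulti, hle, hge⟩ := h.near.exists_merge hne hp hwm hwm' hdw hdw' hdm
  have hfw : f w ≠ f w' := fun he => hwm (mem_multi.2 ⟨w, w', hne, rfl, he.symm⟩)
  have hsub : ∀ T₁, T₁ ⊆ T → (nonadj L f T₁ \ {f w, f w'}).card + 2 = (nonadj L f T₁).card := by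
    intro T₁ hT₁
    have h1 : ({f w, f w'} : Finset α) ⊆ nonadj L f T₁ := by
      rw [insert_subset_iff, singleton_subset_iff]
      exact ⟨nonadj_anti hT₁ hw, nonadj_anti hT₁ hw'⟩
    rw [← card_pair hfw, card_sdiff_add_card_eq_card h1]
  have hmax' : ∀ T₁, (nonadj L f T₁).card + T₁.card = Fintype.card α + 1 → T₁ ⊆ T := by
    intro T₁ hT₁
    have h1 := nonadj_supermodular (L := L) (f := f) (T := T) (T' := T₁)
    have h2 := h.card_le (T ∪ T₁)
    have h3 := h.card_le (T ∩ T₁)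
    have h4 := h.card_eq
    have h5 := card_le_card (subset_union_left (s₁ := T) (s₂ := T₁))
    have h6 := h.multi_le
    have h7 := hmax f (T ∪ T₁) ⟨h.near, by omega, h.card_le, by omega⟩
    exact union_eq_left.1 (eq_of_subset_of_card_le subset_union_left h7).symm
  have hb : ∀ T₁, (nonadj L f' T₁).card + T₁.card ≤ Fintype.card α + 1 := by
    intro T₁
    rcases T₁.eq_empty_or_nonempty with rfl | hT₁
    · have : (nonadj L f' ∅).card ≤ Fintype.card α := card_le_univ _
      rw [card_empty]
      omega
    · have h1 := hle T₁ hT₁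
      have h2 := h.card_le T₁
      have h0 : (nonadj L f T₁ \ {f w, f w'}).card ≤ (nonadj L f T₁).card :=
        card_le_card sdiff_subset
      by_cases h3 : (nonadj L f T₁).card + T₁.card = Fintype.card α + 1
      · have h4 := hsub T₁ (hmax' T₁ h3)
        omega
      · omega
  have hlow : ∀ T₁, T₁ ⊆ T → (nonadj L f' T₁).card + T₁.card ≤ Fintype.card α := by
    intro T₁ hT₁
    rcases T₁.eq_empty_or_nonempty with rfl | hne₁
    · rw [card_empty]
      exact card_le_univ _
    · have h1 := hle T₁ hne₁
      have h2 := h.card_le T₁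
      have h3 := hsub T₁ hT₁
      omega
  obtain ⟨T₂, hT₂⟩ := hc.exists_viol hf'
  have h1 := nonadj_supermodular (L := L) (f := f') (T := T) (T' := T₂)
  have h2 := hge T hd
  have h3 := hsub T subset_rfl
  have h4 := hlow _ (inter_subset_left (s₁ := T) (s₂ := T₂))
  have h5 := hb (T ∪ T₂)
  have h6 := h.card_eq
  have h7 := hT₂.2
  have h8 : T.card < (T ∪ T₂).card := by
    refine card_lt_card (Finset.ssubset_iff_subset_ne.2 ⟨subset_union_left, fun he => ?_⟩)
    have h9 := hlow T₂ (union_eq_left.1 he.symm)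
    omega
  have h9 := h.multi_le
  exact absurd (hmax f' (T ∪ T₂) ⟨hf', by omega, hb, by omega⟩) (by omega)

/-- There is no minimal non-colourable instance. -/
theorem Crit.false (hc : Crit p L) : False := by
  have hk := card_idx hc.surj
  have h1 : (safe p L).card < (largeIdx p).card := hc.card_safe_lt fun c => mem_safe.1
  have h2 := hc.le_card_colours
  obtain ⟨c, hcs, hmax⟩ := exists_max_image (safe p L)ᶜ
    (fun c => singDeg p L c + largeDeg p L c) (by
      rw [← card_pos, card_compl]
      omega)
  rw [mem_compl] at hcs
  have hm : ∀ c' ∉ safe p L, singDeg p L c' + largeDeg p L c' ≤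
      singDeg p L c + largeDeg p L c := fun c' hc' => hmax c' (mem_compl.2 hc')
  have hmκ : singDeg p L c + largeDeg p L c ≤ (sing p).card + (largeIdx p).card := by
    have := hc.deg_le_of_notMem_safe hcs
    omega
  obtain ⟨u, hu, huc⟩ : ∃ u ∈ sing p, c ∉ L u := by
    by_contra hno
    push Not at hno
    obtain ⟨f, T, h, hcT⟩ := exists_viol_of_notMem_safe hcs
    have h3 := h.card_meet_le hc hm hmκ
    have h4 := singDeg_le_card_meet (p := p) (L := L) hcT
    have h5 : singDeg p L c = (sing p).card := by
      rw [singDeg, filter_true_of_mem hno]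
    have h6 := hc.card_colours_le
    omega
  obtain ⟨f₀, hf₀, hcf₀, hmulti, hle⟩ := hc.exists_state hu huc
  obtain ⟨T₀, hT₀⟩ := hc.exists_viol hf₀
  have h3 := hT₀.deg_le hc (hcf₀ T₀ hT₀)
  have h0 : Tight p L (singDeg p L c + largeDeg p L c) f₀ T₀ :=
    ⟨hf₀, le_antisymm (hle T₀) hT₀.2, hle, by omega⟩
  obtain ⟨x, hx, hxmax⟩ := exists_max_image
    (univ.filter fun x : (V → α) × Finset α =>
      Tight p L (singDeg p L c + largeDeg p L c) x.1 x.2)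
    (fun x => x.2.card) ⟨(f₀, T₀), mem_filter.2 ⟨mem_univ _, h0⟩⟩
  obtain ⟨f', T', h', hlt⟩ := (mem_filter.1 hx).2.exists_larger hc hm hmκ
  exact absurd (hxmax (f', T') (mem_filter.2 ⟨mem_univ _, h'⟩)) (not_le.2 hlt)

end Final

section Induction

universe u v w

lemma good_of_card_le_card {V : Type u} {ι : Type v} {α : Type w} [Fintype V] (p : V → ι)
    {L : V → Finset α} (h : ∀ v, Fintype.card V ≤ (L v).card) : Good p L := by
  obtain ⟨f, hf, hfL⟩ := (all_card_le_biUnion_card_iff_exists_injective L).1 fun A => by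
    rcases A.eq_empty_or_nonempty with rfl | ⟨a, ha⟩
    · simp
    · exact ((card_le_univ A).trans (h a)).trans (card_le_card (subset_biUnion_of_mem L ha))
  exact ⟨f, hfL, fun u w huw => by rw [hf huw]⟩

lemma Good.mono {V : Type u} {ι : Type v} {α : Type w} {p p' : V → ι} {L : V → Finset α}
    (hp : ∀ u w, p' u = p' w → p u = p w) : Good p' L → Good p L :=
  fun ⟨f, hfL, hf⟩ => ⟨f, hfL, fun u w huw => hp u w (hf u w huw)⟩

/-- A partition into few parts can be refined so that no part is empty. -/
lemma exists_surjective_refinement {V : Type u} {ι : Type v} [Fintype V] [Fintype ι]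
    (p : V → ι) (h : Fintype.card ι ≤ Fintype.card V) :
    ∃ p' : V → ι, Surjective p' ∧ ∀ u w, p' u = p' w → p u = p w := by
  obtain ⟨p', hp', hmax⟩ := exists_max_image
    (univ.filter fun p' : V → ι => ∀ u w, p' u = p' w → p u = p w)
    (fun p' => (univ.image p').card) ⟨p, by simp⟩
  replace hp' := (mem_filter.1 hp').2
  refine ⟨p', fun i => ?_, hp'⟩
  by_contra hi
  push Not at hi
  have hninj : ¬ Injective p' := fun hinj =>
    hi _ (((Fintype.bijective_iff_injective_and_card p').2
      ⟨hinj, le_antisymm (Fintype.card_le_of_injective p' hinj) h⟩).2 i).choose_spec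
  simp only [Injective, not_forall] at hninj
  obtain ⟨a, b, hab, hne⟩ := hninj
  have hmem : update p' a i ∈ univ.filter fun p' : V → ι => ∀ u w, p' u = p' w → p u = p w := by
    refine mem_filter.2 ⟨mem_univ _, fun u w huw => ?_⟩
    by_cases hu : u = a <;> by_cases hw : w = a
    · rw [hu, hw]
    · rw [hu, update_self, update_of_ne hw] at huw
      exact absurd huw.symm (hi w)
    · rw [hw, update_self, update_of_ne hu] at huw
      exact absurd huw (hi u)
    · rw [update_of_ne hu, update_of_ne hw] at huw
      exact hp' u w huw
  refine absurd (hmax _ hmem) (not_le.2 (card_lt_card ?_))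
  rw [Finset.ssubset_iff_of_subset]
  · refine ⟨i, mem_image.2 ⟨a, mem_univ _, update_self ..⟩, ?_⟩
    simpa using hi
  · intro j hj
    obtain ⟨x, -, rfl⟩ := mem_image.1 hj
    by_cases hx : x = a
    · exact mem_image.2 ⟨b, mem_univ _, by rw [update_of_ne (Ne.symm hne), hx, hab]⟩
    · exact mem_image.2 ⟨x, mem_univ _, update_of_ne hx ..⟩

/-- The list colouring statement for all partitions of fewer than `N` vertices into parts. -/
def Below (N : ℕ) : Prop :=
  ∀ (V : Type u) (ι : Type v) (α : Type w) [Fintype V] [Fintype ι] (p : V → ι)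
    (L : V → Finset α), Fintype.card V < N → Fintype.card V ≤ 2 * Fintype.card ι + 1 →
    (∀ v, Fintype.card ι ≤ (L v).card) → Good p L

variable {V : Type u} {ι : Type v} {α : Type w} [Fintype V] [Fintype ι]
variable {p : V → ι} {L : V → Finset α}

/-- If the lists on a part have a common colour, the part can be coloured and deleted. -/
lemma Below.good_of_common (ih : Below.{u, v, w} (Fintype.card V)) {i : ι} {c : α}
    (hpos : 0 < (part p i).card)
    (hcard : Fintype.card V + 1 ≤ 2 * Fintype.card ι + (part p i).card)
    (hL : ∀ v, Fintype.card ι ≤ (L v).card) (hci : ∀ v, p v = i → c ∈ L v) : Good p L := by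
  have hV : Fintype.card {v // p v ≠ i} + (part p i).card = Fintype.card V := by
    rw [Fintype.card_subtype, add_comm]
    exact card_filter_add_card_filter_not (s := univ) (fun v => p v = i)
  have hι : Fintype.card {j // j ≠ i} + 1 = Fintype.card ι := by
    have h : (univ.filter fun j => j ≠ i) = univ.erase i := by
      ext j
      simp
    rw [Fintype.card_subtype, h, card_erase_add_one (mem_univ i), card_univ]
  obtain ⟨f, hfL, hf⟩ := ih {v // p v ≠ i} {j // j ≠ i} α (fun v => ⟨p v.1, v.2⟩)
    (fun v => (L v.1).erase c) (by omega) (by omega) (fun v => by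
      have h1 := pred_card_le_card_erase (s := L v.1) (a := c)
      have h2 := hL v.1
      omega)
  refine ⟨fun v => if h : p v ≠ i then f ⟨v, h⟩ else c, fun v => ?_, fun u w huw => ?_⟩
  · by_cases h : p v ≠ i
    · simpa only [h, dif_pos, not_false_eq_true, ne_eq] using mem_of_mem_erase (hfL ⟨v, h⟩)
    · simpa only [h, dif_neg, not_false_eq_true] using hci v (not_not.1 h)
  · dsimp only at huw
    by_cases hu : p u ≠ i <;> by_cases hw : p w ≠ i
    · rw [dif_pos hu, dif_pos hw] at huw
      exact congrArg Subtype.val (hf _ _ huw)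
    · rw [dif_pos hu, dif_neg hw] at huw
      exact absurd huw (ne_of_mem_erase (hfL ⟨u, hu⟩))
    · rw [dif_neg hu, dif_pos hw] at huw
      exact absurd huw.symm (ne_of_mem_erase (hfL ⟨w, hw⟩))
    · exact (not_not.1 hu).trans (not_not.1 hw).symm

/-- If the colours cannot be assigned distinct hosts, the instance can be coloured. -/
lemma Below.exists_host (ih : Below.{u, v, w} (Fintype.card V)) [Fintype α]
    (hcard : Fintype.card V ≤ 2 * Fintype.card ι + 1) (hL : ∀ v, Fintype.card ι ≤ (L v).card)
    (hused : ∀ c, ∃ v, c ∈ L v) (hng : ¬ Good p L) :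
    ∃ g : α → V, Injective g ∧ ∀ c, c ∈ L (g c) := by
  choose g₀ hg₀ using hused
  let N : α → Finset V := fun c => univ.filter fun v => c ∈ L v
  have hN : ∀ c v, v ∈ N c ↔ c ∈ L v := fun c v => by simp [N]
  by_contra hno
  have hhall : ∃ T : Finset α, (T.biUnion N).card < T.card := by
    by_contra h
    push Not at h
    obtain ⟨g, hg, hgN⟩ := (all_card_le_biUnion_card_iff_exists_injective N).1 h
    exact hno ⟨g, hg, fun c => (hN _ _).1 (hgN c)⟩
  obtain ⟨T₁, hT₁⟩ := hhall
  obtain ⟨T, hT, hmin⟩ := exists_min_image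
    (univ.filter fun T : Finset α => (T.biUnion N).card < T.card) card
    ⟨T₁, mem_filter.2 ⟨mem_univ _, hT₁⟩⟩
  replace hT := (mem_filter.1 hT).2
  obtain ⟨t, ht⟩ : T.Nonempty := card_pos.1 (by omega)
  have hce := card_erase_of_mem ht
  obtain ⟨e, he, hinj⟩ := exists_injOn_of_hall g₀ (s := T.erase t) N fun A hA => by
    by_contra hcon
    have h1 := hmin A (mem_filter.2 ⟨mem_univ _, not_le.1 hcon⟩)
    have h2 := card_le_card hA
    omega
  have himg : (T.erase t).image e = T.biUnion N := by
    refine eq_of_subset_of_card_le (fun v hv => ?_) ?_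
    · obtain ⟨c, hc, rfl⟩ := mem_image.1 hv
      exact mem_biUnion.2 ⟨c, mem_of_mem_erase hc, he c hc⟩
    · rw [card_image_of_injOn hinj]
      omega
  have hpre : ∀ v, v ∈ T.biUnion N → ∃ c ∈ T, c ∈ L v ∧ e c = v := fun v hv => by
    rw [← himg] at hv
    obtain ⟨c, hc, rfl⟩ := mem_image.1 hv
    exact ⟨c, mem_of_mem_erase hc, (hN _ _).1 (he c hc), rfl⟩
  have : Nonempty α := ⟨t⟩
  choose! r hrT hrL hre using hpre
  have hlt : Fintype.card {v // v ∉ T.biUnion N} < Fintype.card V :=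
    Fintype.card_subtype_lt (x := g₀ t)
      (not_not.2 (mem_biUnion.2 ⟨t, ht, (hN _ _).2 (hg₀ t)⟩))
  obtain ⟨f, hfL, hf⟩ := ih {v // v ∉ T.biUnion N} ι α (fun v => p v.1) (fun v => L v.1) hlt
    (hlt.le.trans hcard) fun v => hL v.1
  have hfT : ∀ v h, f ⟨v, h⟩ ∉ T := fun v h hT =>
    h (mem_biUnion.2 ⟨_, hT, (hN _ _).2 (hfL ⟨v, h⟩)⟩)
  refine hng ⟨fun v => if h : v ∉ T.biUnion N then f ⟨v, h⟩ else r v, fun v => ?_,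
    fun u w huw => ?_⟩
  · dsimp only
    by_cases h : v ∉ T.biUnion N
    · rw [dif_pos h]
      exact hfL ⟨v, h⟩
    · rw [dif_neg h]
      exact hrL v (not_not.1 h)
  · dsimp only at huw
    by_cases hu : u ∉ T.biUnion N <;> by_cases hw : w ∉ T.biUnion N
    · rw [dif_pos hu, dif_pos hw] at huw
      exact hf _ _ huw
    · rw [dif_pos hu, dif_neg hw] at huw
      exact absurd (huw ▸ hrT w (not_not.1 hw)) (hfT u hu)
    · rw [dif_neg hu, dif_pos hw] at huw
      exact absurd (huw ▸ hrT u (not_not.1 hu)) (hfT w hw)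
    · rw [dif_neg hu, dif_neg hw] at huw
      rw [← hre u (not_not.1 hu), huw, hre w (not_not.1 hw)]

lemma Below.card_eq (ih : Below.{u, v, w} (Fintype.card V)) [Fintype α] (hp : Surjective p)
    (hcard : Fintype.card V ≤ 2 * Fintype.card ι + 1) (hL : ∀ v, Fintype.card ι ≤ (L v).card)
    (hng : ¬ Good p L) {g : α → V} (hg : Injective g) (hgL : ∀ c, c ∈ L (g c)) :
    Fintype.card V = 2 * Fintype.card ι + 1 := by
  by_contra hne
  have hlt : Fintype.card α < Fintype.card V := by
    refine lt_of_le_of_ne (Fintype.card_le_of_injective g hg) fun h => hng ?_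
    have hb := (Fintype.bijective_iff_injective_and_card g).2 ⟨hg, h⟩
    choose r hr using hb.2
    exact ⟨r, fun v => by simpa only [hr] using hgL (r v), fun u w huw => by
      rw [← hr u, huw, hr w]⟩
  have hno : ∀ i c, ∃ v, p v = i ∧ c ∉ L v := by
    intro i c
    by_contra hcon
    push Not at hcon
    have := one_le_card_part hp i
    exact hng (ih.good_of_common (c := c) (i := i) (by omega) (by omega) hL hcon)
  obtain ⟨i, -, hi⟩ : ∃ i ∈ (univ : Finset ι), (part p i).card ≤ 2 := by
    by_contra hcon
    push Not at hcon
    have h1 := card_filter_mem (p := p) univ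
    have h2 : ∑ i : ι, 3 ≤ ∑ i : ι, (part p i).card := sum_le_sum hcon
    simp only [mem_univ, filter_true, card_univ, sum_const, smul_eq_mul] at h1 h2
    omega
  have h1 := one_le_card_part hp i
  have hi2 : (part p i).card = 2 := by
    by_contra hi2
    obtain ⟨v, hv⟩ := card_eq_one.1 (show (part p i).card = 1 by omega)
    have hk : 0 < Fintype.card ι := Fintype.card_pos_iff.2 ⟨i⟩
    obtain ⟨c, hc⟩ : (L v).Nonempty := card_pos.1 (hk.trans_le (hL v))
    obtain ⟨x, hx, hcx⟩ := hno i c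
    rw [← mem_part, hv, mem_singleton] at hx
    exact hcx (hx ▸ hc)
  obtain ⟨a, b, hab, hpart⟩ := card_eq_two.1 hi2
  have hdisj : Disjoint (L a) (L b) := by
    rw [Finset.disjoint_left]
    intro c ha hb
    obtain ⟨x, hx, hcx⟩ := hno i c
    rw [← mem_part, hpart, mem_insert, mem_singleton] at hx
    rcases hx with rfl | rfl
    · exact hcx ha
    · exact hcx hb
  have h2 : (L a ∪ L b).card ≤ Fintype.card α := card_le_univ _
  rw [card_union_of_disjoint hdisj] at h2
  have h3 := hL a
  have h4 := hL b
  omega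

lemma Below.good (ih : Below.{u, v, w} (Fintype.card V)) [Fintype α] (hp : Surjective p)
    (hcard : Fintype.card V ≤ 2 * Fintype.card ι + 1) (hL : ∀ v, Fintype.card ι ≤ (L v).card)
    (hused : ∀ c, ∃ v, c ∈ L v) : Good p L := by
  by_contra hng
  obtain ⟨M, hM, hmax⟩ := exists_max_image
    (univ.filter fun M : V → Finset α => (∀ v, L v ⊆ M v) ∧ ¬ Good p M)
    (fun M => ∑ v, (M v).card) ⟨L, mem_filter.2 ⟨mem_univ _, fun _ => subset_rfl, hng⟩⟩
  obtain ⟨-, hLM, hMng⟩ := mem_filter.1 hM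
  have hMcard : ∀ v, Fintype.card ι ≤ (M v).card := fun v => (hL v).trans (card_le_card (hLM v))
  obtain ⟨g, hg, hgM⟩ := ih.exists_host hcard hMcard
    (fun c => (hused c).imp fun v hv => hLM v hv) hMng
  refine Crit.false (p := p) (L := M) ⟨hp, ih.card_eq hp hcard hMcard hMng hg hgM, hMcard, hMng,
    fun c i hci => ?_, ⟨g, hg, hgM⟩, fun v c hcv => ?_⟩
  · by_contra hi
    exact hMng (ih.good_of_common (by omega) (by omega) hMcard hci)
  · by_contra hcon
    refine absurd (hmax _ (mem_filter.2 ⟨mem_univ _, fun x => ?_, hcon⟩)) (not_le.2 ?_)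
    · by_cases hx : x = v
      · subst hx
        rw [update_self]
        exact (hLM x).trans (subset_insert _ _)
      · rw [update_of_ne hx]
        exact hLM x
    · refine sum_lt_sum (fun x _ => ?_) ⟨v, mem_univ _, ?_⟩
      · by_cases hx : x = v
        · subst hx
          rw [update_self]
          exact card_le_card (subset_insert _ _)
        · rw [update_of_ne hx]
      · rw [update_self, card_insert_of_notMem hcv]
        exact Nat.lt_succ_self _

/-- Restriction of the colours to those appearing in the lists. -/
lemma good_of_good_subtype {s : Finset α}
    (h : Good p fun v => (L v).subtype fun c => c ∈ s) : Good p L := by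
  obtain ⟨f, hfL, hf⟩ := h
  exact ⟨fun v => (f v).1, fun v => mem_subtype.1 (hfL v),
    fun u w huw => hf u w (Subtype.ext huw)⟩

theorem below (N : ℕ) : Below.{u, v, w} N := by
  induction N with
  | zero => exact fun V ι α _ _ p L h => absurd h (Nat.not_lt_zero _)
  | succ N ih =>
    intro V ι α _ _ p L hN hcard hL
    by_cases hlt : Fintype.card V < N
    · exact ih V ι α p L hlt hcard hL
    obtain rfl : Fintype.card V = N := by omega
    rcases le_total (Fintype.card V) (Fintype.card ι) with h | h
    · exact good_of_card_le_card p fun v => h.trans (hL v)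
    obtain ⟨p', hp', hpp'⟩ := exists_surjective_refinement p h
    refine Good.mono hpp' ?_
    have hs : ∀ v, L v ⊆ univ.biUnion L := fun v => subset_biUnion_of_mem L (mem_univ v)
    refine good_of_good_subtype (s := univ.biUnion L) (ih.good hp' hcard (fun v => ?_) fun c => ?_)
    · rw [card_subtype, filter_true_of_mem fun c hc => hs v hc]
      exact hL v
    · obtain ⟨v, -, hv⟩ := mem_biUnion.1 c.2
      exact ⟨v, mem_subtype.2 hv⟩

end Induction

end

end Ohba

/-- Ohba's conjecture (theorem of Noel, Reed and Wu): a `k`-colourable graph on at most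
`2 * k + 1` vertices is colourable from all lists of size at least `k`. -/
theorem listColourable_of_card_le {V : Type*} [Fintype V] (G : SimpleGraph V) (k : ℕ)
    (hG : G.Colorable k) (hcard : Fintype.card V ≤ 2 * k + 1)
    (L : V → Finset ℕ) (hL : ∀ v, k ≤ (L v).card) : ListColourable G L := by
  obtain ⟨f⟩ := hG
  obtain ⟨g, hgL, hg⟩ := Ohba.below (Fintype.card V + 1) V (Fin k) ℕ f L (Nat.lt_succ_self _)
    (by simpa using hcard) (by simpa using hL)
  exact ⟨g, hgL, fun u w huw h => f.valid huw (hg u w h)⟩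

/-- If the lists meet `t` disjoint colour sets `D i` and, disjointly from those, a set `E`
in at least `k - t` colours, then a `k`-colourable graph on at most `2 * k + t + 1`
vertices is colourable from the lists. -/
theorem listColourable_of_disjoint_sets (t : ℕ) :
    ∀ {V : Type*} [Fintype V] (G : SimpleGraph V) (k : ℕ), t < k → G.Colorable k →
      Fintype.card V ≤ 2 * k + t + 1 →
      ∀ (L : V → Finset ℕ) (D : Fin t → Finset ℕ) (E : Finset ℕ),
        (∀ i j, i ≠ j → Disjoint (D i) (D j)) → (∀ i, Disjoint (D i) E) →
        (∀ v i, 1 ≤ (L v ∩ D i).card) → (∀ v, k - t ≤ (L v ∩ E).card) →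
        ListColourable G L := by
  classical
  induction t with
  | zero =>
    intro V _ G k _ hG hcard L D E _ _ _ hE
    exact listColourable_of_card_le G k hG (by simpa using hcard) L
      fun v => (by simpa using hE v : k ≤ _).trans (Finset.card_le_card Finset.inter_subset_left)
  | succ t ih =>
    intro V _ G k htk hG hcard L D E hD hDE hL hE
    obtain ⟨f⟩ := hG
    by_cases hbig : ∃ a : Fin k, 3 ≤ (Finset.univ.filter fun v => f v = a).card
    · obtain ⟨a, ha⟩ := hbig
      let W := {v : V // f v ≠ a}
      have hW : Fintype.card W + (Finset.univ.filter fun v => f v = a).card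
          = Fintype.card V := by
        rw [Fintype.card_subtype, add_comm]
        exact Finset.card_filter_add_card_filter_not (s := Finset.univ) (fun v => f v = a)
      have hcol : (G.comap (Subtype.val : W → V)).Colorable (k - 1) := by
        let g : (G.comap (Subtype.val : W → V)).Coloring {b : Fin k // b ≠ a} :=
          Coloring.mk (fun v => ⟨f v.1, v.2⟩) fun {u w} h => by
            have := f.valid (show G.Adj u.1 w.1 from h)
            simpa [Subtype.ext_iff] using this
        have := g.colorable
        simpa [Fintype.card_subtype_compl] using this
      have hsub : ∀ v : W, k - 1 - t ≤ ((L v.1 \ D (Fin.last t)) ∩ E).card := by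
        intro v
        have h1 : (L v.1 \ D (Fin.last t)) ∩ E = L v.1 ∩ E := by
          ext c
          have : c ∈ D (Fin.last t) → c ∉ E := fun h =>
            Finset.disjoint_left.1 (hDE (Fin.last t)) h
          simp only [Finset.mem_inter, Finset.mem_sdiff]
          tauto
        rw [h1]
        have := hE v.1
        omega
      have hsubD : ∀ (v : W) (i : Fin t),
          1 ≤ ((L v.1 \ D (Fin.last t)) ∩ D i.castSucc).card := by
        intro v i
        have h1 : (L v.1 \ D (Fin.last t)) ∩ D i.castSucc = L v.1 ∩ D i.castSucc := by
          ext c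
          have : c ∈ D i.castSucc → c ∉ D (Fin.last t) := fun h => Finset.disjoint_left.1
            (hD i.castSucc (Fin.last t) (Fin.castSucc_lt_last i).ne) h
          simp only [Finset.mem_inter, Finset.mem_sdiff]
          tauto
        rw [h1]
        exact hL v.1 i.castSucc
      obtain ⟨g, hgL, hg⟩ := ih (G.comap (Subtype.val : W → V)) (k - 1) (by omega) hcol
        (by change Fintype.card W ≤ _; omega) (fun v => L v.1 \ D (Fin.last t))
        (fun i => D i.castSucc) E
        (fun i j hij => hD _ _ fun h => hij (Fin.castSucc_injective _ h)) (fun i => hDE _)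
        hsubD hsub
      have hne : ∀ v, ∃ c, c ∈ L v ∩ D (Fin.last t) := fun v =>
        Finset.card_pos.1 (hL v (Fin.last t))
      choose e he using hne
      have heL : ∀ v, e v ∈ L v := fun v => (Finset.mem_inter.1 (he v)).1
      have heD : ∀ v, e v ∈ D (Fin.last t) := fun v => (Finset.mem_inter.1 (he v)).2
      have hgL' : ∀ v : W, g v ∈ L v.1 := fun v => (Finset.mem_sdiff.1 (hgL v)).1
      have hgD : ∀ v : W, g v ∉ D (Fin.last t) := fun v => (Finset.mem_sdiff.1 (hgL v)).2
      refine ⟨fun v => if h : f v = a then e v else g ⟨v, h⟩, fun v => ?_, fun u w huw => ?_⟩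
      · by_cases h : f v = a
        · simpa [h] using heL v
        · simpa [h] using hgL' ⟨v, h⟩
      · have hfuw := f.valid huw
        by_cases hu : f u = a <;> by_cases hw : f w = a
        · exact absurd (hu.trans hw.symm) hfuw
        · simp only [hu, hw, dif_pos, dif_neg, not_false_iff]
          exact fun h => hgD ⟨w, hw⟩ (h ▸ heD u)
        · simp only [hu, hw, dif_pos, dif_neg, not_false_iff]
          exact fun h => hgD ⟨u, hu⟩ (h ▸ heD w)
        · simp only [hu, hw, dif_neg, not_false_iff]
          exact hg (show G.Adj _ _ from huw)
    · push Not at hbig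
      have hV : Fintype.card V ≤ 2 * k := by
        have := Finset.card_eq_sum_card_fiberwise (s := (Finset.univ : Finset V))
          (t := (Finset.univ : Finset (Fin k))) (f := f)
          (fun _ _ => Finset.mem_coe.2 (Finset.mem_univ _))
        rw [← Finset.card_univ, this]
        calc _ ≤ ∑ _a : Fin k, 2 := Finset.sum_le_sum fun a _ => Nat.lt_succ_iff.1 (hbig a)
          _ = 2 * k := by simp [mul_comm]
      refine listColourable_of_card_le G k ⟨f⟩ (by omega) L fun v => ?_
      have hdisj : Disjoint ((Finset.univ : Finset (Fin (t + 1))).biUnion fun i => L v ∩ D i)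
          (L v ∩ E) := by
        rw [Finset.disjoint_biUnion_left]
        exact fun i _ => (hDE i).mono Finset.inter_subset_right Finset.inter_subset_right
      have hbi : t + 1 ≤ ((Finset.univ : Finset (Fin (t + 1))).biUnion
          fun i => L v ∩ D i).card := by
        rw [Finset.card_biUnion fun i _ j _ hij =>
          (hD i j hij).mono Finset.inter_subset_right Finset.inter_subset_right]
        calc t + 1 = ∑ _i : Fin (t + 1), 1 := by simp
          _ ≤ _ := Finset.sum_le_sum fun i _ => hL v i
      have hle : (((Finset.univ : Finset (Fin (t + 1))).biUnion fun i => L v ∩ D i) ∪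
          (L v ∩ E)).card ≤ (L v).card := Finset.card_le_card <|
        Finset.union_subset (Finset.biUnion_subset.2 fun i _ => Finset.inter_subset_left)
          Finset.inter_subset_left
      rw [Finset.card_union_of_disjoint hdisj] at hle
      have := hE v
      omega

/-- A `lam`-assignment for a multiset `replicate t 1 + {m}` splits into `t` colour sets met
by every list and one further set met in at least `m` colours. -/
theorem IsLamAssignment.exists_sets {V : Type*} {t m : ℕ} (hm : 1 ≤ m) {L : V → Finset ℕ}
    (h : IsLamAssignment (Multiset.replicate t 1 + {m}) L) :
    ∃ (D : Fin t → Finset ℕ) (E : Finset ℕ),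
      (∀ i j, i ≠ j → Disjoint (D i) (D j)) ∧ (∀ i, Disjoint (D i) E) ∧
      (∀ v i, 1 ≤ (L v ∩ D i).card) ∧ ∀ v, m ≤ (L v ∩ E).card := by
  obtain ⟨l, C, hl, hC, hLC⟩ := h
  have hlen : t + 1 = l.length := by
    have := congrArg Multiset.card hl
    simpa using this.symm
  have hmem : m ∈ l := by
    rw [← Multiset.mem_coe, hl]
    simp
  have hpos : ∀ i, 1 ≤ l.get i := by
    intro i
    have hi : l.get i ∈ Multiset.replicate t 1 + {m} := by
      rw [← hl]
      exact List.get_mem l i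
    rcases Multiset.mem_add.1 hi with hi | hi
    · exact (Multiset.eq_of_mem_replicate hi).ge
    · exact hm.trans (Multiset.mem_singleton.1 hi).ge
  obtain ⟨i₀, hi₀⟩ := List.get_of_mem hmem
  let σ : Fin t → Fin l.length :=
    fun i => finCongr hlen (((finCongr hlen).symm i₀).succAbove i)
  have hσ : Function.Injective σ :=
    (finCongr hlen).injective.comp Fin.succAbove_right_injective
  have hσ₀ : ∀ i, σ i ≠ i₀ := fun i hi =>
    Fin.succAbove_ne ((finCongr hlen).symm i₀) i ((Equiv.eq_symm_apply _).2 hi)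
  exact ⟨fun i => C (σ i), C i₀, fun i j hij => hC _ _ (hσ.ne hij), fun i => hC _ _ (hσ₀ i),
    fun v i => (hpos _).trans (hLC v _), fun v => hi₀ ▸ hLC v i₀⟩

theorem lambda_kt_choosable {V : Type*} [Fintype V] (G : SimpleGraph V)
    (k t : ℕ) (ht : t < k)
    (hchr : G.chromaticNumber = (k : ℕ∞))
    (hcard : Fintype.card V ≤ 2 * k + t + 1) :
    LamChoosable G (Multiset.replicate t 1 + {k - t}) := by
  intro L hL
  obtain ⟨D, E, hD, hDE, h1, h2⟩ := hL.exists_sets (Nat.sub_pos_of_lt ht)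
  exact listColourable_of_disjoint_sets t G k ht
    (chromaticNumber_le_iff_colorable.1 hchr.le) hcard L D E hD hDE h1 h2
end

section
/- Let k and t be integers with 0 ≤ t < k, and let λ_{k,t} be the multiset consisting of t copies of 1 together with one copy of k − t. A finite simple graph G is λ_{k,t}-choosable if and only if G is L-colourable for every list assignment L of G such that |L(v)| ≥ k for every vertex v and there exists a set T of at least t colours with T ⊆ L(v) for every vertex v. -/
open SimpleGraph

/-- A finite set with at least `t` elements contains the range of an injective sequence of
length `t`. -/
lemma Finset.exists_injOn_range_of_le_card {T : Finset ℕ} {t : ℕ} (hT : t ≤ T.card) :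
    ∃ g : ℕ → ℕ, Set.InjOn g (Finset.range t) ∧ ∀ j < t, g j ∈ T := by
  obtain ⟨S, hST, hS⟩ := Finset.exists_subset_card_eq hT
  refine ⟨fun j => if h : j < t then S.orderEmbOfFin hS ⟨j, h⟩ else 0, ?_, ?_⟩
  · intro a ha b hb hab
    have ha' : a < t := by simpa using ha
    have hb' : b < t := by simpa using hb
    simpa [ha', hb'] using hab
  · intro j hj
    simpa [hj] using hST (S.orderEmbOfFin_mem hS ⟨j, hj⟩)

/-- Lists of size at least `k` sharing `t` common colours form a `λ_{k,t}`-list assignment. -/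
lemma isLamAssignment_of_common_colours {V : Type*} [Fintype V] {k t : ℕ} {L : V → Finset ℕ}
    (hL : ∀ v, k ≤ (L v).card) {T : Finset ℕ} (hT : t ≤ T.card) (hTL : ∀ v, T ⊆ L v) :
    IsLamAssignment (Multiset.replicate t 1 + {k - t}) L := by
  obtain ⟨g, hg, hgT⟩ := Finset.exists_injOn_range_of_le_card hT
  let S := (Finset.range t).image g
  have hS : S.card = t := by simpa using Finset.card_image_of_injOn hg
  have mem_S : ∀ j < t, g j ∈ S := fun j hj =>
    Finset.mem_image_of_mem g (Finset.mem_range.2 hj)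
  have hSL : ∀ v, S ⊆ L v := by
    intro v x hx
    obtain ⟨j, hj, rfl⟩ := Finset.mem_image.1 hx
    exact hTL v (hgT j (Finset.mem_range.1 hj))
  refine ⟨(k - t) :: List.replicate t 1,
    fun i => if i.val = 0 then Finset.univ.biUnion L \ S else {g (i.val - 1)}, ?_, ?_, ?_⟩
  · rw [add_comm, Multiset.singleton_add, ← Multiset.cons_coe, Multiset.coe_replicate]
  · rintro ⟨i, hi⟩ ⟨j, hj⟩ hij
    simp only [List.length_cons, List.length_replicate] at hi hj
    have hij' : i ≠ j := fun h => hij (Fin.ext h)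
    rcases i with _ | i <;> rcases j with _ | j
    · exact absurd rfl hij'
    · simp [mem_S j (by omega)]
    · simp [mem_S i (by omega)]
    · have : g i ≠ g j := fun h =>
        hij' (congrArg Nat.succ (hg (by simp; omega) (by simp; omega) h))
      simpa using this
  · rintro v ⟨i, hi⟩
    simp only [List.length_cons, List.length_replicate] at hi
    rcases i with _ | i
    · have hsub : L v \ S ⊆ L v ∩ (Finset.univ.biUnion L \ S) := by
        intro x hx
        rw [Finset.mem_sdiff] at hx
        simp only [Finset.mem_inter, Finset.mem_sdiff, Finset.mem_biUnion, Finset.mem_univ,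
          true_and]
        exact ⟨hx.1, ⟨v, hx.1⟩, hx.2⟩
      have h := Finset.card_le_card hsub
      rw [Finset.card_sdiff_of_subset (hSL v), hS] at h
      have := hL v
      simp only [List.get_eq_getElem, List.getElem_cons_zero, if_true]
      omega
    · have : g i ∈ L v := hSL v (mem_S i (by omega))
      simp [this]

/-- In a `λ_{k,t}`-list assignment of a nonempty vertex set, identifying all colours in each of
`t` of the colour classes gives lists of size at least `k` sharing `t` common colours. -/
lemma IsLamAssignment.exists_image_common_colours {V : Type*} [Nonempty V] {k t : ℕ} (ht : t < k)
    {L : V → Finset ℕ} (hL : IsLamAssignment (Multiset.replicate t 1 + {k - t}) L) :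
    ∃ φ : ℕ → ℕ, (∀ v, k ≤ ((L v).image φ).card) ∧
      ∃ T : Finset ℕ, t ≤ T.card ∧ ∀ v, T ⊆ (L v).image φ := by
  classical
  obtain ⟨l, C, hl, hdisj, hcard⟩ := hL
  have hlen : l.length = t + 1 := by simpa using congrArg Multiset.card hl
  have hmem : ∀ x, x ∈ l ↔ x ∈ Multiset.replicate t 1 + {k - t} := by simp [← hl]
  obtain ⟨m, hm⟩ := List.get_of_mem ((hmem (k - t)).2 (by simp))
  have hpos : ∀ i, 1 ≤ l.get i := by
    intro i
    have h := (hmem _).1 (l.get_mem i)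
    rw [Multiset.mem_add, Multiset.mem_singleton] at h
    rcases h with h | h
    · exact (Multiset.eq_of_mem_replicate h).ge
    · omega
  have hne : ∀ v i, ∃ x, x ∈ L v ∧ x ∈ C i := by
    intro v i
    obtain ⟨x, hx⟩ := Finset.card_pos.1 ((hpos i).trans (hcard v i))
    exact ⟨x, Finset.mem_inter.1 hx⟩
  have huniq : ∀ {i j x}, x ∈ C i → x ∈ C j → i = j := by
    intro i j x hi hj
    by_contra hij
    exact Finset.disjoint_left.1 (hdisj i j hij) hi hj
  choose c _ hc using hne (Classical.arbitrary V)
  let φ : ℕ → ℕ := fun x => if h : ∃ i, i ≠ m ∧ x ∈ C i then c h.choose else x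
  have hφ : ∀ {i x}, i ≠ m → x ∈ C i → φ x = c i := by
    intro i x hi hx
    have h : ∃ i, i ≠ m ∧ x ∈ C i := ⟨i, hi, hx⟩
    simp only [φ, dif_pos h]
    rw [huniq h.choose_spec.2 hx]
  have hφm : ∀ {x}, x ∈ C m → φ x = x := by
    intro x hx
    refine dif_neg ?_
    rintro ⟨i, hi, hxi⟩
    exact hi (huniq hxi hx)
  let T := (Finset.univ.erase m).image c
  have hT : T.card = t := by
    have hinj : Function.Injective c := fun i j hij => huniq (hc i) (hij ▸ hc j)
    rw [Finset.card_image_of_injective _ hinj]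
    simp [hlen]
  have hTL : ∀ v, T ⊆ (L v).image φ := by
    intro v x hx
    obtain ⟨i, hi, rfl⟩ := Finset.mem_image.1 hx
    obtain ⟨y, hyL, hyC⟩ := hne v i
    exact Finset.mem_image.2 ⟨y, hyL, hφ (Finset.ne_of_mem_erase hi) hyC⟩
  refine ⟨φ, fun v => ?_, T, hT.ge, hTL⟩
  have hd : Disjoint T (L v ∩ C m) := by
    refine Finset.disjoint_left.2 fun x hx hxm => ?_
    obtain ⟨i, hi, rfl⟩ := Finset.mem_image.1 hx
    exact Finset.ne_of_mem_erase hi (huniq (hc i) (Finset.mem_inter.1 hxm).2)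
  have hsub : T ∪ (L v ∩ C m) ⊆ (L v).image φ := by
    refine Finset.union_subset (hTL v) fun x hx => ?_
    rw [Finset.mem_inter] at hx
    exact Finset.mem_image.2 ⟨x, hx.1, hφm hx.2⟩
  have h := Finset.card_le_card hsub
  rw [Finset.card_union_of_disjoint hd, hT] at h
  have := hcard v m
  omega

/-- A colouring from the images of the lists under a map of colours lifts to the lists. -/
lemma ListColourable.of_image {V : Type*} {G : SimpleGraph V} {L : V → Finset ℕ} {φ : ℕ → ℕ}
    (h : ListColourable G fun v => (L v).image φ) : ListColourable G L := by
  obtain ⟨f, hf, hadj⟩ := h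
  choose g hgL hg using fun v => Finset.mem_image.1 (hf v)
  exact ⟨g, hgL, fun u w huw heq => hadj huw (by rw [← hg u, ← hg w, heq])⟩

theorem lambda_kt_choosable_iff {V : Type*} [Fintype V] (G : SimpleGraph V)
    (k t : ℕ) (ht : t < k) :
    LamChoosable G (Multiset.replicate t 1 + {k - t}) ↔
      ∀ L : V → Finset ℕ, (∀ v, k ≤ (L v).card) →
        (∃ T : Finset ℕ, t ≤ T.card ∧ ∀ v, T ⊆ L v) →
        ListColourable G L := by
  constructor
  · rintro h L hL ⟨T, hT, hTL⟩
    exact h L (isLamAssignment_of_common_colours hL hT hTL)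
  · intro h L hL
    cases isEmpty_or_nonempty V
    · exact ⟨fun _ => 0, fun v => isEmptyElim v, fun u => isEmptyElim u⟩
    · obtain ⟨φ, hcard, hT⟩ := hL.exists_image_common_colours ht
      exact (h _ hcard hT).of_image
end

section
/- Let a ≥ 0 and b ≥ 1 be integers, let λ be the multiset consisting of a copies of 1 and b copies of 2, and let k = k_λ = a + 2b. Let G be the complete k-partite graph with a + b + 1 parts of size 3 and b − 1 parts of size 1. Then G has chromatic number k, G has exactly 2k + a + 2 vertices, and G is not λ-choosable. -/
open SimpleGraph

/-- The parts of the complete multipartite graph `K_{3*(a+b+1), 1*(b-1)}`: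
`a + b + 1` parts of size `3` and `b - 1` parts of size `1`. -/
def PartsK (a b : ℕ) : Fin (a + b + 1) ⊕ Fin (b - 1) → Type :=
  Sum.elim (fun _ => Fin 3) (fun _ => Fin 1)

instance (a b : ℕ) (i : Fin (a + b + 1) ⊕ Fin (b - 1)) : Fintype (PartsK a b i) := by
  cases i <;> exact Fin.fintype _

/-- The forbidden residue of a vertex: its position within its part. -/
def vertexResidue (a b : ℕ) : (Σ i, PartsK a b i) → ℕ
  | ⟨.inl _, t⟩ => Fin.val (n := 3) t
  | ⟨.inr _, _⟩ => 0

lemma vertexResidue_lt (a b : ℕ) (v : Σ i, PartsK a b i) : vertexResidue a b v < 3 := by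
  obtain ⟨i | i, t⟩ := v
  · exact Fin.isLt (n := 3) t
  · exact Nat.zero_lt_succ _

/-- The bad lists: every vertex gets all of the `a` common colours `0, …, a - 1`, and from each
of the `b` consecutive triples of colours that follow, the two colours whose residue is not the
forbidden one. -/
def badLists (a b : ℕ) (v : Σ i, PartsK a b i) : Finset ℕ :=
  (Finset.range (a + 3 * b)).filter fun c => c < a ∨ (c - a) % 3 ≠ vertexResidue a b v

lemma mem_badLists {a b : ℕ} {v : Σ i, PartsK a b i} {c : ℕ} :
    c ∈ badLists a b v ↔ c < a + 3 * b ∧ (c < a ∨ (c - a) % 3 ≠ vertexResidue a b v) := by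
  simp [badLists]

lemma isLamAssignment_badLists (a b : ℕ) :
    IsLamAssignment (Multiset.replicate a 1 + Multiset.replicate b 2) (badLists a b) := by
  refine ⟨List.replicate a 1 ++ List.replicate b 2, fun i => if i.val < a then {i.val} else
    Finset.Ico (a + 3 * (i.val - a)) (a + 3 * (i.val - a) + 3), ?_, ?_, ?_⟩
  · rw [← Multiset.coe_add, Multiset.coe_replicate, Multiset.coe_replicate]
  · intro i j hij
    have hne : i.val ≠ j.val := fun h => hij (Fin.ext h)
    rw [Finset.disjoint_left]
    intro c hi hj
    dsimp only at hi hj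
    split_ifs at hi hj <;> simp only [Finset.mem_singleton, Finset.mem_Ico] at hi hj <;> omega
  · rintro v ⟨i, hi⟩
    have hlen : i < a + b := by simpa using hi
    by_cases hia : i < a
    · have hmem : i ∈ badLists a b v := mem_badLists.2 ⟨by omega, Or.inl hia⟩
      simp [hia, hmem]
    · have hr := vertexResidue_lt a b v
      set r := vertexResidue a b v with hrdef
      have hsub : {a + 3 * (i - a) + (r + 1) % 3, a + 3 * (i - a) + (r + 2) % 3} ⊆
          badLists a b v ∩ Finset.Ico (a + 3 * (i - a)) (a + 3 * (i - a) + 3) := by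
        intro c hc
        simp only [Finset.mem_insert, Finset.mem_singleton] at hc
        simp only [Finset.mem_inter, mem_badLists, Finset.mem_Ico, ← hrdef]
        omega
      have hcard := Finset.card_le_card hsub
      rw [Finset.card_pair (by omega)] at hcard
      simpa [hia, List.getElem_append_right (as := List.replicate a 1) (bs := List.replicate b 2)
        (i := i) (by simpa using hia)] using hcard

/-- Common colours have weight two, all other colours have weight one. -/
def colourWeight (a c : ℕ) : ℕ := if c < a then 2 else 1

lemma sum_colourWeight (a b : ℕ) :
    ∑ c ∈ Finset.range (a + 3 * b), colourWeight a c = 2 * a + 3 * b := by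
  rw [Finset.sum_range_add, Finset.sum_congr rfl (g := fun _ => 2)]
  · simp [colourWeight, mul_comm]
  · intro c hc
    simp [colourWeight, Finset.mem_range.1 hc]

lemma one_le_colourWeight (a c : ℕ) : 1 ≤ colourWeight a c := by
  unfold colourWeight; split_ifs <;> omega

/-- The colours used on a part of size three have total weight at least two. -/
lemma two_le_sum_colourWeight {a b : ℕ} {f : (Σ i, PartsK a b i) → ℕ}
    (hf : ∀ v, f v ∈ badLists a b v) (i : Fin (a + b + 1)) :
    2 ≤ ∑ c ∈ Finset.univ.image (fun t : PartsK a b (.inl i) => f ⟨.inl i, t⟩),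
      colourWeight a c := by
  have hmem (t : PartsK a b (.inl i)) :
      f ⟨.inl i, t⟩ ∈ Finset.univ.image (fun t : PartsK a b (.inl i) => f ⟨.inl i, t⟩) :=
    Finset.mem_image_of_mem _ (Finset.mem_univ t)
  by_cases h : ∃ t : PartsK a b (.inl i), f ⟨.inl i, t⟩ < a
  · obtain ⟨t, ht⟩ := h
    calc 2 = colourWeight a (f ⟨.inl i, t⟩) := by simp [colourWeight, ht]
      _ ≤ _ := Finset.single_le_sum (fun _ _ => Nat.zero_le _) (hmem t)
  · push Not at h
    let s : PartsK a b (.inl i) := (0 : Fin 3)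
    let t : PartsK a b (.inl i) :=
      (⟨(f ⟨.inl i, s⟩ - a) % 3, Nat.mod_lt _ (by omega)⟩ : Fin 3)
    have hne : f ⟨.inl i, s⟩ ≠ f ⟨.inl i, t⟩ := by
      intro heq
      rcases (mem_badLists.1 (hf ⟨.inl i, t⟩)).2 with hlt | hres
      · exact absurd hlt (not_lt.2 (h t))
      · exact hres (by rw [← heq]; rfl)
    calc 2 ≤ ∑ c ∈ {f ⟨.inl i, s⟩, f ⟨.inl i, t⟩}, colourWeight a c := by
          rw [Finset.sum_pair hne]
          exact add_le_add (one_le_colourWeight _ _) (one_le_colourWeight _ _)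
      _ ≤ _ := Finset.sum_le_sum_of_subset (by
          intro c hc
          rw [Finset.mem_insert, Finset.mem_singleton] at hc
          rcases hc with rfl | rfl <;> exact hmem _)

lemma one_le_sum_colourWeight {a b : ℕ} (f : (Σ i, PartsK a b i) → ℕ) (i : Fin (b - 1)) :
    1 ≤ ∑ c ∈ Finset.univ.image (fun t : PartsK a b (.inr i) => f ⟨.inr i, t⟩),
      colourWeight a c := by
  let s : PartsK a b (.inr i) := (0 : Fin 1)
  exact (one_le_colourWeight a (f ⟨.inr i, s⟩)).trans
    (Finset.single_le_sum (fun _ _ => Nat.zero_le _)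
      (Finset.mem_image_of_mem _ (Finset.mem_univ s)))

lemma not_listColourable_badLists (a b : ℕ) (hb : 1 ≤ b) :
    ¬ ListColourable (completeMultipartiteGraph (PartsK a b)) (badLists a b) := by
  rintro ⟨f, hf, hadj⟩
  let S (p : Fin (a + b + 1) ⊕ Fin (b - 1)) : Finset ℕ :=
    Finset.univ.image fun t : PartsK a b p => f ⟨p, t⟩
  have hdisj : ((Finset.univ : Finset (Fin (a + b + 1) ⊕ Fin (b - 1))) : Set _).PairwiseDisjoint
      S := by
    intro p _ q _ hpq
    rw [Function.onFun, Finset.disjoint_left]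
    intro c hp hq
    obtain ⟨t, -, rfl⟩ := Finset.mem_image.1 hp
    obtain ⟨u, -, hu⟩ := Finset.mem_image.1 hq
    exact hadj (u := ⟨p, t⟩) (w := ⟨q, u⟩) hpq hu.symm
  have hsub : Finset.univ.biUnion S ⊆ Finset.range (a + 3 * b) := by
    intro c hc
    obtain ⟨p, -, hp⟩ := Finset.mem_biUnion.1 hc
    obtain ⟨t, -, rfl⟩ := Finset.mem_image.1 hp
    exact Finset.mem_range.2 (mem_badLists.1 (hf _)).1
  have hupper := Finset.sum_le_sum_of_subset (f := colourWeight a) hsub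
  rw [sum_colourWeight, Finset.sum_biUnion hdisj, Fintype.sum_sum_type] at hupper
  have hlarge := Finset.card_nsmul_le_sum Finset.univ
    (fun i => ∑ c ∈ S (.inl i), colourWeight a c) 2 fun i _ => two_le_sum_colourWeight hf i
  have hsmall := Finset.card_nsmul_le_sum Finset.univ
    (fun i => ∑ c ∈ S (.inr i), colourWeight a c) 1 fun i _ => one_le_sum_colourWeight f i
  simp only [Finset.card_univ, Fintype.card_fin, smul_eq_mul] at hlarge hsmall
  omega

/-- A complete multipartite graph with finitely many parts, all nonempty, has chromatic number
the number of parts. -/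
lemma chromaticNumber_completeMultipartiteGraph {ι : Type*} [Fintype ι] (V : ι → Type*)
    (s : ∀ i, V i) :
    (completeMultipartiteGraph V).chromaticNumber = (Fintype.card ι : ℕ∞) := by
  apply le_antisymm
  · exact (Coloring.mk (Sigma.fst : (Σ i, V i) → ι) fun h => h).colorable.chromaticNumber_le
  · rw [← chromaticNumber_top]
    exact chromaticNumber_mono_of_hom
      (⟨fun i => ⟨i, s i⟩, fun h => h⟩ : (⊤ : SimpleGraph ι) →g completeMultipartiteGraph V)

theorem completeMultipartite_not_choosable (a b : ℕ) (hb : 1 ≤ b) :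
    (completeMultipartiteGraph (PartsK a b)).chromaticNumber
        = ((a + 2 * b : ℕ) : ℕ∞) ∧
    Fintype.card (Σ i, PartsK a b i) = 2 * (a + 2 * b) + a + 2 ∧
    ¬ LamChoosable (completeMultipartiteGraph (PartsK a b))
        (Multiset.replicate a 1 + Multiset.replicate b 2) := by
  refine ⟨?_, ?_, fun h =>
    not_listColourable_badLists a b hb (h _ (isLamAssignment_badLists a b))⟩
  · rw [chromaticNumber_completeMultipartiteGraph (PartsK a b)
      (Sum.rec (fun _ => (0 : Fin 3)) (fun _ => (0 : Fin 1)))]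
    congr 1
    simp only [Fintype.card_sum, Fintype.card_fin]
    omega
  · have hlarge (i : Fin (a + b + 1)) : Fintype.card (PartsK a b (.inl i)) = 3 :=
      Fintype.card_fin 3
    have hsmall (i : Fin (b - 1)) : Fintype.card (PartsK a b (.inr i)) = 1 :=
      Fintype.card_fin 1
    simp only [Fintype.card_sigma, Fintype.sum_sum_type, hlarge, hsmall, Finset.sum_const,
      Finset.card_univ, Fintype.card_fin, smul_eq_mul]
    omega
end

section
/- Let λ be a multiset of positive integers with sum k = k_λ in which every element is at least 2. Let G be the complete k-partite graph with one part of size 5 and k − 1 parts of size 2 (so G has 2k + 3 vertices and chromatic number k). Then G is not λ-choosable. -/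
open SimpleGraph

/-- The parts of the complete multipartite graph `K_{1*5, (k-1)*2}`:
one part of size `5` and `k - 1` parts of size `2`. -/
def PartsK' (k : ℕ) : Fin 1 ⊕ Fin (k - 1) → Type :=
  Sum.elim (fun _ => Fin 5) (fun _ => Fin 2)

instance (k : ℕ) (i : Fin 1 ⊕ Fin (k - 1)) : Fintype (PartsK' k i) := by
  cases i <;> exact Fin.fintype _

/-- The colour with number `t` on side `s` of the `i`-th block. -/
def blockColour (i s t : ℕ) : ℕ := Nat.pair i (Nat.pair s t)

theorem blockColour_inj {i s t i' s' t' : ℕ} :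
    blockColour i s t = blockColour i' s' t' ↔ i = i' ∧ s = s' ∧ t = t' := by
  simp [blockColour, Nat.pair_eq_pair]

theorem blockColour_injective (i s : ℕ) : Function.Injective (blockColour i s) :=
  fun _ _ h => (blockColour_inj.1 h).2.2

/-- The colours of the `i`-th block with number in `P` on side `0` or number in `Q` on side `1`. -/
def blockColours (i : ℕ) (P Q : Finset ℕ) : Finset ℕ :=
  P.image (blockColour i 0) ∪ Q.image (blockColour i 1)

theorem mem_blockColours {i c : ℕ} {P Q : Finset ℕ} :
    c ∈ blockColours i P Q ↔
      (∃ t ∈ P, blockColour i 0 t = c) ∨ ∃ t ∈ Q, blockColour i 1 t = c := by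
  simp [blockColours]

theorem card_blockColours (i : ℕ) (P Q : Finset ℕ) :
    (blockColours i P Q).card = P.card + Q.card := by
  rw [blockColours, Finset.card_union_of_disjoint,
    Finset.card_image_of_injective _ (blockColour_injective i 0),
    Finset.card_image_of_injective _ (blockColour_injective i 1)]
  simp [Finset.disjoint_left, blockColour_inj]

theorem blockColours_mono (i : ℕ) {P Q P' Q' : Finset ℕ} (hP : P ⊆ P') (hQ : Q ⊆ Q') :
    blockColours i P Q ⊆ blockColours i P' Q' :=
  Finset.union_subset_union (Finset.image_subset_image hP) (Finset.image_subset_image hQ)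

theorem disjoint_blockColours {i j : ℕ} (hij : i ≠ j) (P Q P' Q' : Finset ℕ) :
    Disjoint (blockColours i P Q) (blockColours j P' Q') := by
  rw [Finset.disjoint_left]
  intro c hc hc'
  rw [mem_blockColours] at hc hc'
  rcases hc with ⟨t, -, rfl⟩ | ⟨t, -, rfl⟩ <;>
    rcases hc' with ⟨t', -, h⟩ | ⟨t', -, h⟩ <;>
    exact hij (blockColour_inj.1 h).1.symm

/-- Union over all blocks `i` of the colours selected by `P (l i)` and `Q (l i)`. -/
def assemble (l : List ℕ) (P Q : ℕ → Finset ℕ) : Finset ℕ :=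
  Finset.univ.biUnion fun i : Fin l.length => blockColours i (P (l.get i)) (Q (l.get i))

theorem card_assemble (l : List ℕ) (P Q : ℕ → Finset ℕ) :
    (assemble l P Q).card = ∑ i : Fin l.length, ((P (l.get i)).card + (Q (l.get i)).card) := by
  rw [assemble, Finset.card_biUnion]
  · simp only [card_blockColours]
  · intro i _ j _ hij
    exact disjoint_blockColours (fun h => hij (Fin.ext h)) _ _ _ _

theorem le_card_assemble_inter (l : List ℕ) {P Q : ℕ → Finset ℕ}
    (hP : ∀ k, P k ⊆ Finset.range k) (hQ : ∀ k, Q k ⊆ Finset.range k) (i : Fin l.length)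
    (h : l.get i ≤ (P (l.get i)).card + (Q (l.get i)).card) :
    l.get i ≤
      (assemble l P Q ∩
        blockColours i (Finset.range (l.get i)) (Finset.range (l.get i))).card := by
  rw [← card_blockColours i] at h
  refine h.trans (Finset.card_le_card (Finset.subset_inter ?_ (blockColours_mono _ (hP _) (hQ _))))
  exact Finset.subset_biUnion_of_mem
    (fun i : Fin l.length => blockColours i (P (l.get i)) (Q (l.get i))) (Finset.mem_univ i)

/-- Numbers of the side `0` colours, in a block with parameter `k`, available at the `j`-th
vertex of the part of size five. -/
def firstSide (j : Fin 5) (k : ℕ) : Finset ℕ :=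
  ![Finset.Ico (k / 2) k, Finset.Ico (k - k / 2) k, Finset.range (k - k / 2),
    Finset.range (k / 2), Finset.range (k / 2) ∪ Finset.Ico (k - k / 2) k] j

/-- Numbers of the side `1` colours, in a block with parameter `k`, available at the `j`-th
vertex of the part of size five. -/
def secondSide (j : Fin 5) (k : ℕ) : Finset ℕ :=
  ![Finset.Ico (k - k / 2) k, Finset.range (k - k / 2), Finset.range (k / 2),
    Finset.Ico (k / 2) k, Finset.range (k / 2) ∪ Finset.Ico (k - k / 2) k] j

theorem firstSide_subset_range (j : Fin 5) (k : ℕ) : firstSide j k ⊆ Finset.range k := by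
  intro t
  fin_cases j <;> simp [firstSide] <;> omega

theorem secondSide_subset_range (j : Fin 5) (k : ℕ) : secondSide j k ⊆ Finset.range k := by
  intro t
  fin_cases j <;> simp [secondSide] <;> omega

theorem le_card_firstSide_add_card_secondSide (j : Fin 5) {k : ℕ} (hk : 2 ≤ k) :
    k ≤ (firstSide j k).card + (secondSide j k).card := by
  have hd : Disjoint (Finset.range (k / 2)) (Finset.Ico (k - k / 2) k) := by
    rw [Finset.disjoint_left]
    intro t
    simp only [Finset.mem_range, Finset.mem_Ico]
    omega
  fin_cases j <;> simp [firstSide, secondSide, Finset.card_union_of_disjoint hd] <;> omega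

/-- The complements of `firstSide j k × secondSide j k'` cover all pairs (a pinwheel covering). -/
theorem exists_notMem_firstSide_secondSide (k k' t t' : ℕ) :
    ∃ j, t ∉ firstSide j k ∧ t' ∉ secondSide j k' := by
  by_contra! h
  have h0 := h 0
  have h1 := h 1
  have h2 := h 2
  have h3 := h 3
  have h4 := h 4
  simp [firstSide, secondSide] at h0 h1 h2 h3 h4
  omega

theorem blockColour_mem_assemble_zero {l : List ℕ} {P Q : ℕ → Finset ℕ} {i : Fin l.length}
    {t : ℕ} : blockColour i 0 t ∈ assemble l P Q ↔ t ∈ P (l.get i) := by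
  simp only [assemble, Finset.mem_biUnion, Finset.mem_univ, true_and, mem_blockColours]
  constructor
  · rintro ⟨j, ⟨u, hu, h⟩ | ⟨u, hu, h⟩⟩
    · obtain ⟨hj, -, rfl⟩ := blockColour_inj.1 h
      obtain rfl := Fin.ext hj
      exact hu
    · exact absurd (blockColour_inj.1 h).2.1 one_ne_zero
  · exact fun h => ⟨i, Or.inl ⟨t, h, rfl⟩⟩

theorem blockColour_mem_assemble_one {l : List ℕ} {P Q : ℕ → Finset ℕ} {i : Fin l.length}
    {t : ℕ} : blockColour i 1 t ∈ assemble l P Q ↔ t ∈ Q (l.get i) := by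
  simp only [assemble, Finset.mem_biUnion, Finset.mem_univ, true_and, mem_blockColours]
  constructor
  · rintro ⟨j, ⟨u, hu, h⟩ | ⟨u, hu, h⟩⟩
    · exact absurd (blockColour_inj.1 h).2.1 zero_ne_one
    · obtain ⟨hj, -, rfl⟩ := blockColour_inj.1 h
      obtain rfl := Fin.ext hj
      exact hu
  · exact fun h => ⟨i, Or.inr ⟨t, h, rfl⟩⟩

theorem assemble_subset_union (l : List ℕ) {P Q : ℕ → Finset ℕ}
    (hP : ∀ k, P k ⊆ Finset.range k) (hQ : ∀ k, Q k ⊆ Finset.range k) :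
    assemble l P Q ⊆
      assemble l Finset.range (fun _ => ∅) ∪ assemble l (fun _ => ∅) Finset.range := by
  intro c hc
  simp only [assemble, Finset.mem_biUnion, Finset.mem_univ, true_and, mem_blockColours] at hc
  obtain ⟨i, ⟨t, ht, rfl⟩ | ⟨t, ht, rfl⟩⟩ := hc
  · exact Finset.mem_union_left _ (blockColour_mem_assemble_zero.2 (hP _ ht))
  · exact Finset.mem_union_right _ (blockColour_mem_assemble_one.2 (hQ _ ht))

theorem exists_notMem_assemble (l : List ℕ) {x y : ℕ}
    (hx : x ∈ assemble l Finset.range (fun _ => ∅))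
    (hy : y ∈ assemble l (fun _ => ∅) Finset.range) :
    ∃ j, x ∉ assemble l (firstSide j) (secondSide j) ∧
      y ∉ assemble l (firstSide j) (secondSide j) := by
  simp only [assemble, Finset.mem_biUnion, Finset.mem_univ, true_and, mem_blockColours,
    Finset.notMem_empty, false_and, exists_false, or_false, false_or] at hx hy
  obtain ⟨i, t, -, rfl⟩ := hx
  obtain ⟨i', t', -, rfl⟩ := hy
  obtain ⟨j, hj⟩ := exists_notMem_firstSide_secondSide (l.get i) (l.get i') t t'
  exact ⟨j, by rwa [blockColour_mem_assemble_zero, blockColour_mem_assemble_one]⟩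

/-- The lists with `S j` at the `j`-th vertex of the part of size five, and `X`, `Y` at the two
vertices of every part of size two. -/
def partLists (k : ℕ) (S : Fin 5 → Finset ℕ) (X Y : Finset ℕ) :
    (Σ i, PartsK' k i) → Finset ℕ
  | ⟨Sum.inl _, j⟩ => S j
  | ⟨Sum.inr _, s⟩ => (![X, Y] : Fin 2 → Finset ℕ) s

/-- An injective choice of `k - 1` elements from a set of size `k` misses exactly one element. -/
theorem exists_sdiff_image_eq_singleton {k : ℕ} (hk : 1 ≤ k) {X : Finset ℕ} (hX : X.card = k)
    {g : Fin (k - 1) → ℕ} (hg : Function.Injective g) (hgX : ∀ p, g p ∈ X) :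
    ∃ x, X \ Finset.univ.image g = {x} := by
  rw [← Finset.card_eq_one, Finset.card_sdiff_of_subset
    (Finset.image_subset_iff.2 fun p _ => hgX p), Finset.card_image_of_injective _ hg, hX,
    Finset.card_univ, Fintype.card_fin]
  omega

theorem not_listColourable_partLists {k : ℕ} (hk : 1 ≤ k) {S : Fin 5 → Finset ℕ}
    {X Y : Finset ℕ} (hX : X.card = k) (hY : Y.card = k) (hS : ∀ j, S j ⊆ X ∪ Y)
    (hcover : ∀ x ∈ X, ∀ y ∈ Y, ∃ j, x ∉ S j ∧ y ∉ S j) :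
    ¬ ListColourable (completeMultipartiteGraph (PartsK' k)) (partLists k S X Y) := by
  rintro ⟨f, hf, hadj⟩
  let five : Fin 5 → Σ i, PartsK' k i := fun j => ⟨Sum.inl 0, j⟩
  let two : Fin 2 → Fin (k - 1) → Σ i, PartsK' k i := fun s p => ⟨Sum.inr p, s⟩
  have hinj : ∀ s, Function.Injective fun p => f (two s p) := by
    intro s p p' h
    by_contra hne
    exact hadj (u := two s p) (w := two s p') (fun h' => hne (Sum.inr_injective h')) h
  have hne : ∀ s j p, f (two s p) ≠ f (five j) := fun s j p =>
    hadj (u := two s p) (w := five j) (fun h' => Sum.inr_ne_inl h')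
  obtain ⟨x, hx⟩ := exists_sdiff_image_eq_singleton hk hX (hinj 0) fun p => hf (two 0 p)
  obtain ⟨y, hy⟩ := exists_sdiff_image_eq_singleton hk hY (hinj 1) fun p => hf (two 1 p)
  have hxX : x ∈ X := (Finset.mem_sdiff.1 (hx ▸ Finset.mem_singleton_self x)).1
  have hyY : y ∈ Y := (Finset.mem_sdiff.1 (hy ▸ Finset.mem_singleton_self y)).1
  obtain ⟨j, hxj, hyj⟩ := hcover x hxX y hyY
  have hfj : f (five j) ∈ S j := hf (five j)
  have hunused : ∀ s, f (five j) ∉ Finset.univ.image fun p => f (two s p) := by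
    intro s h
    obtain ⟨p, -, hp⟩ := Finset.mem_image.1 h
    exact hne s j p hp
  rcases Finset.mem_union.1 (hS j hfj) with h | h
  · have := Finset.mem_sdiff.2 ⟨h, hunused 0⟩
    rw [hx, Finset.mem_singleton] at this
    exact hxj (this ▸ hfj)
  · have := Finset.mem_sdiff.2 ⟨h, hunused 1⟩
    rw [hy, Finset.mem_singleton] at this
    exact hyj (this ▸ hfj)

theorem isLamAssignment_partLists (k : ℕ) (l : List ℕ) (h2 : ∀ x ∈ l, 2 ≤ x) :
    IsLamAssignment (l : Multiset ℕ)
      (partLists k (fun j => assemble l (firstSide j) (secondSide j))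
        (assemble l Finset.range fun _ => ∅) (assemble l (fun _ => ∅) Finset.range)) := by
  refine ⟨l, fun i => blockColours i (Finset.range (l.get i)) (Finset.range (l.get i)), rfl,
    fun i j hij => disjoint_blockColours (fun h => hij (Fin.ext h)) _ _ _ _, ?_⟩
  rintro ⟨_ | _, v⟩ i
  · exact le_card_assemble_inter l (firstSide_subset_range v) (secondSide_subset_range v) i
      (le_card_firstSide_add_card_secondSide v (h2 _ (l.get_mem i)))
  · revert v
    change ∀ s : Fin 2, _
    rw [Fin.forall_fin_two]
    exact ⟨le_card_assemble_inter l (fun _ => subset_rfl) (fun _ => Finset.empty_subset _) i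
        (by simp),
      le_card_assemble_inter l (fun _ => Finset.empty_subset _) (fun _ => subset_rfl) i
        (by simp)⟩

theorem completeMultipartite_one_five_not_choosable (lam : Multiset ℕ)
    (h2 : ∀ x ∈ lam, 2 ≤ x) :
    ¬ LamChoosable (completeMultipartiteGraph (PartsK' lam.sum)) lam := by
  intro hch
  induction lam using Quotient.inductionOn with
  | h l =>
  change LamChoosable _ (l : Multiset ℕ) at hch
  have hlen : ∑ i : Fin l.length, l.get i = (l : Multiset ℕ).sum := by
    simp [Fin.sum_univ_getElem]
  rcases Nat.eq_zero_or_pos (l : Multiset ℕ).sum with h0 | hk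
  · have hl : l = [] := by
      rw [List.eq_nil_iff_forall_not_mem]
      intro x hx
      have := h2 x hx
      have := Multiset.single_le_sum (fun _ _ => Nat.zero_le _) x (Multiset.mem_coe.2 hx)
      omega
    subst hl
    obtain ⟨f, hf, -⟩ := hch (fun _ => ∅)
      ⟨[], fun _ => ∅, rfl, fun i => i.elim0, fun _ i => i.elim0⟩
    exact Finset.notMem_empty _ (hf ⟨Sum.inl 0, (0 : Fin 5)⟩)
  · refine not_listColourable_partLists hk ?_ ?_ ?_ ?_
      (hch _ (isLamAssignment_partLists _ l h2))
    · rw [card_assemble, ← hlen]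
      simp
    · rw [card_assemble, ← hlen]
      simp
    · exact fun j =>
        assemble_subset_union l (firstSide_subset_range j) (secondSide_subset_range j)
    · exact fun x hx y hy => exists_notMem_assemble l hx hy
end

section
/- Let G be a finite simple graph, let X be an independent set of vertices of G, and let λ be a multiset of positive integers. If the induced subgraph G − X (on the vertices outside X) is λ-choosable, then G is (λ ∪ {1})-choosable, where λ ∪ {1} is the multiset obtained from λ by adding one copy of 1. -/
open SimpleGraph

/-- From a `(k ::ₘ lam)`-list assignment one can split off a colour set `D` meeting every list in at
least `k` colours, such that the lists remain a `lam`-list assignment after `D` is removed. -/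
theorem IsLamAssignment.exists_sdiff {V : Type*} {k : ℕ} {lam : Multiset ℕ} {L : V → Finset ℕ}
    (hL : IsLamAssignment (k ::ₘ lam) L) :
    ∃ D : Finset ℕ, (∀ v, k ≤ (L v ∩ D).card) ∧ IsLamAssignment lam fun v => L v \ D := by
  obtain ⟨l, C, hl, hC, hcard⟩ := hL
  have hk : k ∈ l := by
    rw [← Multiset.mem_coe, hl]
    exact Multiset.mem_cons_self k lam
  obtain ⟨i, hi, rfl⟩ := List.getElem_of_mem hk
  have hlen : (l.eraseIdx i).length + 1 = l.length := List.length_eraseIdx_add_one hi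
  let e : Fin (l.eraseIdx i).length → Fin l.length := fun j =>
    ⟨if (j : ℕ) < i then j else j + 1, by split <;> omega⟩
  have he : Function.Injective e := by
    intro a b hab
    simp only [e, Fin.mk.injEq] at hab
    apply Fin.ext
    split_ifs at hab <;> omega
  have hei : ∀ j, e j ≠ ⟨i, hi⟩ := by
    intro j hj
    simp only [e, Fin.mk.injEq] at hj
    split_ifs at hj <;> omega
  have hget : ∀ j, (l.eraseIdx i).get j = l.get (e j) := by
    intro j
    simp only [List.get_eq_getElem, List.getElem_eraseIdx, e]
    split_ifs <;> rfl
  refine ⟨C ⟨i, hi⟩, fun v => hcard v ⟨i, hi⟩, l.eraseIdx i, C ∘ e, ?_,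
    fun a b hab => hC _ _ (he.ne hab), fun v j => ?_⟩
  · rw [← Multiset.cons_inj_right l[i], ← hl, Multiset.cons_coe, Multiset.coe_eq_coe]
    exact List.getElem_cons_eraseIdx_perm hi
  · have hinter : (L v \ C ⟨i, hi⟩) ∩ C (e j) = L v ∩ C (e j) := by
      rw [Finset.sdiff_inter_right_comm, Finset.sdiff_eq_self_of_disjoint]
      exact (hC _ _ (hei j)).mono_left Finset.inter_subset_right
    rw [hget, Function.comp_apply, hinter]
    exact hcard v (e j)

theorem choosable_of_delete_independent_set {V : Type*} [Fintype V]
    (G : SimpleGraph V) (X : Set V)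
    (hX : ∀ u ∈ X, ∀ v ∈ X, ¬ G.Adj u v)
    (lam : Multiset ℕ)
    (h : LamChoosable (G.induce Xᶜ) lam) :
    LamChoosable G (1 ::ₘ lam) := by
  classical
  intro L hL
  obtain ⟨D, hD, l, C, hl, hC, hcard⟩ := hL.exists_sdiff
  obtain ⟨f, hf, hadj⟩ := h (fun v => L v \ D) ⟨l, C, hl, hC, fun v => hcard v⟩
  choose g hg using fun v => Finset.card_pos.mp (hD v)
  simp only [Finset.mem_inter] at hg
  simp only [Finset.mem_sdiff] at hf
  refine ⟨fun v => if hv : v ∈ X then g v else f ⟨v, hv⟩, fun v => ?_, fun u w huw => ?_⟩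
  · by_cases hv : v ∈ X
    · simpa [hv] using (hg v).1
    · simpa [hv] using (hf ⟨v, hv⟩).1
  · by_cases hu : u ∈ X <;> by_cases hw : w ∈ X <;> simp only [hu, hw, dite_true, dite_false]
    · exact absurd huw (hX u hu w hw)
    · exact fun heq => (hf ⟨w, hw⟩).2 (heq ▸ (hg u).2)
    · exact fun heq => (hf ⟨u, hu⟩).2 (heq ▸ (hg w).2)
    · exact hadj (u := ⟨u, hu⟩) (w := ⟨w, hw⟩) huw
end
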